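/- Let K be a field, E a finite set, and W ⊆ K^E any configuration. Then the ideal M_W of submaximal minors of the configuration form Q_W is a radical ideal and equals the radical of the Jacobian ideal J_W (so the second degeneracy scheme Δ_W is reduced and equals the reduced Jacobian scheme Σ_W^red). If moreover char K ≠ 2, then K[x]/J_W is generically reduced: for every minimal prime p of K[x] over J_W, the localization (K[x]/J_W)_p is reduced. -/

import Mathlib

set_option linter.unusedSectionVars false
set_option linter.unusedSimpArgs false
set_option linter.unusedVariables false
set_option linter.flexible false



namespace Config
open Matrix

section MatrixLemmas
variable {A : Type*} [CommRing A] {n : Type*} [Fintype n] [DecidableEq n]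

/-- the adjugate form -/
def af (M : Matrix n n A) (x y : n → A) : A := x ⬝ᵥ (M.adjugate *ᵥ y)

/-- bordered matrix -/
def border (M : Matrix n n A) (p q : n → A) : Matrix (n ⊕ Unit) (n ⊕ Unit) A :=
  fromBlocks M (replicateCol Unit p) (replicateRow Unit q) 0

/-- extension by zero -/
def ext0 (x : n → A) : n ⊕ Unit → A := Sum.elim x 0

/-- second order form -/
def bf (M : Matrix n n A) (q u p v : n → A) : A := - af (border M p q) (ext0 u) (ext0 v)

lemma dot_ext0 (x y : n → A) : ext0 x ⬝ᵥ ext0 y = x ⬝ᵥ y := by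
  simp [ext0, dotProduct]

lemma det_border_aux (M : Matrix n n A) (p q : n → A) :
    (border M p q).det * (- M.det) = M.det * (af M q p) := by
  have h : border M p q * fromBlocks 1 (replicateCol Unit (M.adjugate *ᵥ p)) 0
      (Matrix.of fun _ _ => - M.det) =
      fromBlocks M 0 (replicateRow Unit q) (Matrix.of fun _ _ => af M q p) := by
    unfold border
    rw [fromBlocks_multiply]
    congr 1
    · simp
    · ext i j
      have : (M * replicateCol Unit (M.adjugate *ᵥ p)) i j = (M.det • p) i := by
        have : M *ᵥ (M.adjugate *ᵥ p) = M.det • p := by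
          rw [mulVec_mulVec, mul_adjugate, smul_mulVec, one_mulVec]
        rw [← this]; rfl
      rw [Matrix.add_apply, this]
      simp [Matrix.mul_apply, mul_comm]
    · simp
    · ext i j
      simp [Matrix.mul_apply, af, dotProduct]
  have h2 := congrArg det h
  rw [det_mul, det_fromBlocks_zero₂₁, det_fromBlocks_zero₁₂] at h2
  simpa using h2

lemma af_map {A' : Type*} [CommRing A'] (φ : A →+* A') (M : Matrix n n A) (x y : n → A) :
    φ (af M x y) = af (M.map φ) (φ ∘ x) (φ ∘ y) := by
  have : (M.map φ).adjugate = M.adjugate.map φ := by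
    have := RingHom.map_adjugate φ M
    simpa using this.symm
  unfold af
  rw [this]
  simp [dotProduct, mulVec, Matrix.map_apply, map_sum]

lemma border_map {A' : Type*} [CommRing A'] (φ : A →+* A') (M : Matrix n n A) (p q : n → A) :
    (border M p q).map φ = border (M.map φ) (φ ∘ p) (φ ∘ q) := by
  unfold border
  rw [fromBlocks_map]
  congr 1
  ext i j; simp

lemma det_border (M : Matrix n n A) (p q : n → A) :
    (border M p q).det = - af M q p := by
  classical
  let M' : Matrix n n (Polynomial A) := charmatrix (-M)
  have hmon : M'.det.Monic := (-M).charpoly_monic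
  have h := det_border_aux M' (Polynomial.C ∘ p) (Polynomial.C ∘ q)
  have h2 : (border M' (Polynomial.C ∘ p) (Polynomial.C ∘ q)).det =
      - af M' (Polynomial.C ∘ q) (Polynomial.C ∘ p) := by
    have := hmon.isRegular.left
    apply this
    simp only
    linear_combination -h
  have h3 := congrArg (Polynomial.evalRingHom (0:A)) h2
  have e1 : M'.map (Polynomial.evalRingHom (0:A)) = M := by
    ext i j
    simp [M', charmatrix_apply, Matrix.diagonal_apply]
    split_ifs <;> simp
  have e2 : ∀ x : n → A, (Polynomial.evalRingHom (0:A)) ∘ (Polynomial.C ∘ x) = x := by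
    intro x; ext i; simp
  rw [RingHom.map_det, RingHom.mapMatrix_apply, border_map, map_neg, af_map, e1, e2, e2] at h3
  exact h3

lemma det_rank_one (M : Matrix n n A) (s : A) (u v : n → A) :
    (M + s • vecMulVec v u).det = M.det + s * af M u v := by
  have h1 : (fromBlocks M (replicateCol Unit (- s • v)) (replicateRow Unit u) (1 : Matrix Unit Unit A)).det
      = (M + s • vecMulVec v u).det := by
    rw [det_fromBlocks_one₂₂]
    congr 1
    ext i j
    simp [Matrix.mul_apply, vecMulVec_apply]
    ring
  have e0 : ∀ (q : n → A) (c : A), fromBlocks M (replicateCol Unit (- s • v)) (replicateRow Unit q) (Matrix.of fun _ _ => c : Matrix Unit Unit A)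
      = (border M (-s • v) u).updateRow (Sum.inr ()) (Sum.elim q (fun _ => c)) := by
    intro q c
    ext i j
    rcases i with i | i <;> rcases j with j | j <;> simp [border, updateRow_apply]
  have h2 : (fromBlocks M (replicateCol Unit (- s • v)) (replicateRow Unit u) (1 : Matrix Unit Unit A)).det
     = (border M (-s • v) u).det + (fromBlocks M (replicateCol Unit (- s • v)) 0 (1 : Matrix Unit Unit A)).det := by
    have a1 : (1 : Matrix Unit Unit A) = Matrix.of fun _ _ => 1 := by ext; simp
    have a2 : (replicateRow Unit (0 : n → A)) = 0 := by ext; simp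
    have a3 : (Matrix.of fun _ _ => 0 : Matrix Unit Unit A) = 0 := by ext; simp
    have := e0 u 0
    rw [a3] at this
    change border M (-s • v) u = _ at this
    rw [a1, e0, ← a2, e0]
    conv_rhs => enter [1]; rw [this]
    rw [← det_updateRow_add]
    congr 2
    ext i
    rcases i with i | i <;> simp
  rw [← h1, h2, det_border, det_fromBlocks_zero₂₁]
  simp [af, mulVec_smul, dotProduct_smul, mulVec_neg]
  ring

lemma border_add (M : Matrix n n A) (s : A) (u v p q : n → A) :
    border (M + s • vecMulVec v u) p q = border M p q + s • vecMulVec (ext0 v) (ext0 u) := by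
  ext i j
  rcases i with i | i <;> rcases j with j | j <;> simp [border, ext0, vecMulVec_apply]

lemma af_rank_one (M : Matrix n n A) (s : A) (u v p q : n → A) :
    af (M + s • vecMulVec v u) q p = af M q p + s * bf M q u p v := by
  have h1 := det_border (M + s • vecMulVec v u) p q
  rw [border_add, det_rank_one, det_border] at h1
  unfold bf
  linear_combination h1

lemma adj_border (M : Matrix n n A) (p q : n → A) (u : n → A) :
    ext0 u ⬝ᵥ ((border M p q).adjugate *ᵥ (Sum.elim 0 1)) = - af M u p := by
  have h : ∀ i, (border M p q).adjugate (Sum.inl i) (Sum.inr ()) = - (M.adjugate *ᵥ p) i := by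
    intro i
    rw [adjugate_apply]
    have : (border M p q).updateRow (Sum.inr ()) (Pi.single (Sum.inl i) 1)
        = border M p (Pi.single i 1) := by
      ext a b
      rcases a with a | a <;> rcases b with b | b <;>
        simp [border, updateRow_apply, Pi.single_apply]
    rw [this, det_border]
    simp [af]
  simp [dotProduct, ext0, mulVec, h, af]

lemma det_mul_bf (M : Matrix n n A) (q u p v : n → A) :
    M.det * bf M q u p v = af M q p * af M u v - af M u p * af M q v := by
  have h1 : border M p q *ᵥ (ext0 (M.adjugate *ᵥ v)) =
      M.det • ext0 v + (af M q v) • (Sum.elim (0 : n → A) (1 : Unit → A)) := by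
    have : M *ᵥ (M.adjugate *ᵥ v) = M.det • v := by
      rw [mulVec_mulVec, mul_adjugate, smul_mulVec, one_mulVec]
    ext i
    rcases i with i | i
    · have := congrFun this i
      simp only [border, ext0, fromBlocks_mulVec] at this ⊢
      simpa using this
    · simp [border, ext0, fromBlocks_mulVec, af, mulVec, dotProduct]
  have h2 := congrArg (fun z => ext0 u ⬝ᵥ ((border M p q).adjugate *ᵥ z)) h1
  rw [mulVec_mulVec, adjugate_mul, smul_mulVec, one_mulVec, mulVec_add, mulVec_smul, mulVec_smul,
    dotProduct_add, dotProduct_smul, dotProduct_smul, dotProduct_smul, adj_border, det_border,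
    dot_ext0] at h2
  simp only [smul_eq_mul] at h2
  unfold bf
  unfold af at h2 ⊢
  linear_combination h2

/-- third order identity -/
lemma af_mul_third (M : Matrix n n A) (q p : n → A) (x y z w : n → A) :
    ∃ c, af M q p * c = bf M q x p y * bf M q z p w - bf M q z p y * bf M q x p w := by
  refine ⟨-bf (border M p q) (ext0 x) (ext0 z) (ext0 y) (ext0 w), ?_⟩
  have := det_mul_bf (border M p q) (ext0 x) (ext0 z) (ext0 y) (ext0 w)
  rw [det_border] at this
  unfold bf at this ⊢
  linear_combination this

lemma af_symm (M : Matrix n n A) (hM : M.IsSymm) (x y : n → A) : af M x y = af M y x := by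
  unfold af
  have : M.adjugateᵀ = M.adjugate := by rw [adjugate_transpose, hM]
  rw [dotProduct_mulVec, ← mulVec_transpose, this, dotProduct_comm]

lemma bf_transpose (M : Matrix n n A) (hM : M.IsSymm) (q u p v : n → A) :
    bf M q u p v = bf M p v q u := by
  have h : border M q p = (border M p q)ᵀ := by
    ext i j
    rcases i with i | i <;> rcases j with j | j <;> simp [border, hM.apply]
  unfold bf af
  rw [h, ← adjugate_transpose, dotProduct_mulVec (ext0 v), vecMul_transpose, dotProduct_comm (_ *ᵥ _)]

lemma ext0_map {A' : Type*} [CommRing A'] (φ : A →+* A') (x : n → A) :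
    φ ∘ (ext0 x) = ext0 (φ ∘ x) := by
  ext i
  rcases i with i | i <;> simp [ext0]

lemma bf_map {A' : Type*} [CommRing A'] (φ : A →+* A') (M : Matrix n n A) (q u p v : n → A) :
    φ (bf M q u p v) = bf (M.map φ) (φ ∘ q) (φ ∘ u) (φ ∘ p) (φ ∘ v) := by
  unfold bf
  rw [map_neg, af_map, border_map, ext0_map, ext0_map]

/-- reduction of identities to matrices with regular determinant -/
lemma exists_regular_lift (M : Matrix n n A) : ∃ M' : Matrix n n (Polynomial A),
    M'.map (Polynomial.evalRingHom (0:A)) = M ∧ IsLeftRegular M'.det := by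
  refine ⟨charmatrix (-M), ?_, ((-M).charpoly_monic).isRegular.left⟩
  ext i j
  simp [charmatrix_apply, Matrix.diagonal_apply]
  split_ifs <;> simp

lemma evalC (x : n → A) : (Polynomial.evalRingHom (0:A)) ∘ (Polynomial.C ∘ x) = x := by
  ext i; simp

lemma bf_anti_left (M : Matrix n n A) (q u p v : n → A) : bf M q u p v = - bf M u q p v := by
  obtain ⟨M', h1, h2⟩ := exists_regular_lift M
  have h3 : bf M' (Polynomial.C ∘ q) (Polynomial.C ∘ u) (Polynomial.C ∘ p) (Polynomial.C ∘ v) =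
     - bf M' (Polynomial.C ∘ u) (Polynomial.C ∘ q) (Polynomial.C ∘ p) (Polynomial.C ∘ v) := by
    apply h2
    simp only [mul_neg, det_mul_bf]
    ring
  have h4 := congrArg (Polynomial.evalRingHom (0:A)) h3
  rw [map_neg, bf_map, bf_map, h1] at h4
  simpa only [evalC] using h4

lemma bf_anti_right (M : Matrix n n A) (q u p v : n → A) : bf M q u p v = - bf M q u v p := by
  obtain ⟨M', h1, h2⟩ := exists_regular_lift M
  have h3 : bf M' (Polynomial.C ∘ q) (Polynomial.C ∘ u) (Polynomial.C ∘ p) (Polynomial.C ∘ v) =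
     - bf M' (Polynomial.C ∘ q) (Polynomial.C ∘ u) (Polynomial.C ∘ v) (Polynomial.C ∘ p) := by
    apply h2
    simp only [mul_neg, det_mul_bf]
    ring
  have h4 := congrArg (Polynomial.evalRingHom (0:A)) h3
  rw [map_neg, bf_map, bf_map, h1] at h4
  simpa only [evalC] using h4

lemma bf_self_left (M : Matrix n n A) (q p v : n → A) : bf M q q p v = 0 := by
  obtain ⟨M', h1, h2⟩ := exists_regular_lift M
  have h3 : bf M' (Polynomial.C ∘ q) (Polynomial.C ∘ q) (Polynomial.C ∘ p) (Polynomial.C ∘ v) =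
     0 := by
    apply h2
    simp only [mul_zero, det_mul_bf]
    ring
  have h4 := congrArg (Polynomial.evalRingHom (0:A)) h3
  rw [map_zero, bf_map, h1] at h4
  simpa only [evalC] using h4

lemma bf_add_rank_one (M : Matrix n n A) (s : A) (q u p v : n → A) :
    bf (M + s • vecMulVec p q) q u p v = bf M q u p v := by
  have h1 := af_rank_one M s q p p q
  -- use the row operation
  let z : n ⊕ Unit → A := Sum.elim 0 1
  let U : Matrix (n ⊕ Unit) (n ⊕ Unit) A := 1 + s • vecMulVec z (ext0 q)
  let U' : Matrix (n ⊕ Unit) (n ⊕ Unit) A := 1 - s • vecMulVec z (ext0 q)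
  have hzq : ext0 q ⬝ᵥ z = 0 := by simp [ext0, z, dotProduct]
  have hU : U * U' = 1 := by
    have : vecMulVec z (ext0 q) * vecMulVec z (ext0 q) = 0 := by
      rw [vecMulVec_mul_vecMulVec, hzq]; simp
    simp only [U, U']
    simp only [mul_sub, add_mul, mul_one, one_mul, Matrix.smul_mul, Matrix.mul_smul, this]
    simp
  have hd : U.det = 1 := by
    simp only [U]
    rw [det_rank_one]
    simp [af, hzq]
  have hadj : U.adjugate = U' := by
    calc U.adjugate = U.adjugate * (U * U') := by rw [hU, mul_one]
      _ = U' := by rw [← mul_assoc, adjugate_mul, hd]; simp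
  have hb : border (M + s • vecMulVec p q) p q = border M p q * U := by
    rw [border_add]
    simp only [U]
    rw [mul_add, mul_one, Matrix.mul_smul]
    congr 2
    rw [mul_vecMulVec]
    congr 1
    ext i
    rcases i with i | i <;> simp [border, ext0, z, fromBlocks_mulVec, mulVec, dotProduct]
  have hu : ext0 u ᵥ* U' = ext0 u := by
    simp only [U']
    rw [vecMul_sub, vecMul_smul, vecMul_vecMulVec]
    have : ext0 u ⬝ᵥ z = 0 := by simp [ext0, z, dotProduct]
    simp [this]
  unfold bf af
  rw [hb, adjugate_mul_distrib, hadj, ← mulVec_mulVec, dotProduct_mulVec, hu]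

end MatrixLemmas
end Config


namespace Config

section LemmaB
open Polynomial
variable {A : Type*} [CommRing A] {ι : Type*}

/-- the ideal generated by `N` and the linear polynomials -/
noncomputable def bI (N : Ideal A) (f h : ι → A) : Ideal A[X] :=
  N.map C ⊔ Ideal.span (Set.range fun i => C (f i) * X + C (h i))

lemma bI_le (N : Ideal A) (f h : ι → A) (J : Ideal A[X]) (h1 : ∀ a ∈ N, C a ∈ J)
    (h2 : ∀ i, C (f i) * X + C (h i) ∈ J) : bI N f h ≤ J := by
  refine sup_le (Ideal.map_le_iff_le_comap.2 h1) (Ideal.span_le.2 ?_)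
  rintro _ ⟨i, rfl⟩
  exact h2 i

lemma lemB_ev (N q : Ideal A) [q.IsPrime] (hq : N ≤ q) (f h : ι → A)
    (cross : ∀ i j, f i * h j - f j * h i ∈ N) (i : ι) (hi : f i ∉ q)
    (g : A[X]) (hg : g ∈ (bI N f h).radical) :
    ∃ φ : A →+* FractionRing (A ⧸ q), (∀ a, φ a = 0 ↔ a ∈ q) ∧
      g.eval₂ φ (- φ (h i) / φ (f i)) = 0 := by
  set φ : A →+* FractionRing (A ⧸ q) :=
    (algebraMap (A ⧸ q) (FractionRing (A ⧸ q))).comp (Ideal.Quotient.mk q) with hφ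
  have h0 : ∀ a, φ a = 0 ↔ a ∈ q := by
    intro a
    simp only [hφ, RingHom.comp_apply]
    rw [map_eq_zero_iff _ (IsFractionRing.injective (A ⧸ q) (FractionRing (A ⧸ q))),
      Ideal.Quotient.eq_zero_iff_mem]
  refine ⟨φ, h0, ?_⟩
  have hfi : φ (f i) ≠ 0 := fun hh => hi ((h0 _).1 hh)
  let ev : A[X] →+* FractionRing (A ⧸ q) := eval₂RingHom φ (- φ (h i) / φ (f i))
  have hle : bI N f h ≤ RingHom.ker ev := by
    apply bI_le
    · intro a ha
      simp only [RingHom.mem_ker, ev, coe_eval₂RingHom, eval₂_C]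
      exact (h0 a).2 (hq ha)
    · intro j
      simp only [RingHom.mem_ker, ev, coe_eval₂RingHom, eval₂_C, eval₂_add, eval₂_mul, eval₂_X]
      have := (h0 _).2 (hq (cross i j))
      rw [map_sub, map_mul, map_mul] at this
      field_simp
      linear_combination this
  have hp : (RingHom.ker ev).IsPrime := RingHom.ker_isPrime ev
  exact (hp.radical_le_iff.2 hle) hg

lemma lemB (N m : Ideal A) (f h : ι → A) (hN : N.IsRadical) (hm : m.IsRadical)
    (hm2 : m = N ⊔ Ideal.span (Set.range f))
    (cross : ∀ i j, f i * h j - f j * h i ∈ N)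
    (hmin : ∀ q ∈ N.minimalPrimes, ¬ m ≤ q) : (bI N f h).IsRadical := by
  have hfm : ∀ i, f i ∈ m := fun i => by
    rw [hm2]; exact Ideal.mem_sup_right (Ideal.subset_span ⟨i, rfl⟩)
  have hNm : N ≤ m := by rw [hm2]; exact le_sup_left
  have key : ∀ q : Ideal A, N ≤ q → ¬ m ≤ q → ∃ i, f i ∉ q := by
    intro q hq hmq
    by_contra hcon
    push Not at hcon
    apply hmq
    rw [hm2]
    refine sup_le hq (Ideal.span_le.2 ?_)
    rintro _ ⟨i, rfl⟩; exact hcon i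
  have stepa : ∀ c : A, C c ∈ (bI N f h).radical → c ∈ N := by
    intro c hc
    rw [← hN.radical, ← Ideal.sInf_minimalPrimes, Ideal.mem_sInf]
    intro q hq
    have := hq.1.1
    obtain ⟨i, hi⟩ := key q hq.1.2 (hmin q hq)
    obtain ⟨φ, h0, he⟩ := lemB_ev N q hq.1.2 f h cross i hi _ hc
    rw [eval₂_C] at he
    exact (h0 c).1 he
  have stepb : ∀ (g : A[X]) (d : ℕ), g ∈ (bI N f h).radical → g.natDegree ≤ d + 1 →
      g.coeff (d+1) ∈ m := by
    intro g d hg hd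
    rw [← hm.radical, ← Ideal.sInf_minimalPrimes, Ideal.mem_sInf]
    intro q' hq'
    have := hq'.1.1
    by_cases hall : ∀ i, h i ∈ q'
    · have hle : bI N f h ≤ q'.map C := by
        apply bI_le
        · intro a ha
          exact Ideal.mem_map_of_mem _ (hq'.1.2 (hNm ha))
        · intro j
          exact Ideal.add_mem _ (Ideal.mul_mem_right _ _ (Ideal.mem_map_of_mem _ (hq'.1.2 (hfm j))))
            (Ideal.mem_map_of_mem _ (hall j))
      have hp : (q'.map (C : A →+* A[X])).IsPrime := Ideal.isPrime_map_C_of_isPrime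
      have := (hp.radical_le_iff.2 hle) hg
      exact Ideal.mem_map_C_iff.1 this _
    · push Not at hall
      obtain ⟨i, hi⟩ := hall
      obtain ⟨q, hq, hqq⟩ := Ideal.exists_minimalPrimes_le (hNm.trans hq'.1.2)
      have := hq.1.1
      have hfi : f i ∉ q := by
        intro hfi
        obtain ⟨j, hj⟩ := key q hq.1.2 (hmin q hq)
        have h1 := hq.1.2 (cross i j)
        have h2 : f j * h i ∈ q := by
          have := q.sub_mem (q.mul_mem_right (h j) hfi) h1
          simpa using this
        rcases hq.1.1.mem_or_mem h2 with h3 | h3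
        · exact hj h3
        · exact hi (hqq h3)
      obtain ⟨φ, h0, he⟩ := lemB_ev N q hq.1.2 f h cross i hfi _ hg
      have hf0 : φ (f i) ≠ 0 := fun hh => hfi ((h0 _).1 hh)
      rw [eval₂_eq_sum_range' φ (Nat.lt_succ_of_le hd)] at he
      have hs : ∑ k ∈ Finset.range (d+1+1), g.coeff k * ((- h i)^k * (f i)^(d+1-k)) ∈ q := by
        rw [← h0, map_sum]
        have : ∀ k ∈ Finset.range (d+1+1), φ (g.coeff k * ((- h i)^k * (f i)^(d+1-k))) =
            φ (f i)^(d+1) * (φ (g.coeff k) * (- φ (h i) / φ (f i))^k) := by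
          intro k hk
          have hk' : k ≤ d + 1 := by simpa [Nat.lt_succ_iff] using hk
          rw [map_mul, map_mul, map_pow, map_pow, map_neg, div_pow]
          have : φ (f i) ^ (d+1) = φ (f i) ^ k * φ (f i) ^ (d+1-k) := by
            rw [← pow_add]; congr 1; omega
          rw [this]
          field_simp
        rw [Finset.sum_congr rfl this, ← Finset.mul_sum, he, mul_zero]
      have hs' := hqq hs
      rw [Finset.sum_range_succ] at hs'
      have hrest : ∑ k ∈ Finset.range (d+1), g.coeff k * ((- h i)^k * (f i)^(d+1-k)) ∈ q' := by
        apply Ideal.sum_mem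
        intro k hk
        have hk' : k < d + 1 := by simpa using hk
        apply Ideal.mul_mem_left
        apply Ideal.mul_mem_left
        exact Ideal.pow_mem_of_mem _ (hq'.1.2 (hfm i)) _ (by omega)
      have := (Ideal.add_mem_iff_right _ hrest).1 hs'
      simp only [Nat.sub_self, pow_zero, mul_one] at this
      rcases hq'.1.1.mem_or_mem this with h3 | h3
      · exact h3
      · exact absurd (by simpa using hq'.1.1.mem_of_pow_mem _ h3) hi
  have stepc : ∀ (d : ℕ) (c : A), c ∈ m → ∃ k ∈ bI N f h, k.natDegree ≤ d+1 ∧ k.coeff (d+1) = c := by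
    intro d c hc
    rw [hm2] at hc
    obtain ⟨a, ha, b, hb, rfl⟩ := Submodule.mem_sup.1 hc
    clear hc
    have h2 : ∃ k ∈ bI N f h, k.natDegree ≤ d+1 ∧ k.coeff (d+1) = b := by
      induction hb using Submodule.span_induction with
      | mem x hx =>
        obtain ⟨i, rfl⟩ := hx
        refine ⟨(C (f i) * X + C (h i)) * X ^ d, Ideal.mul_mem_right _ _
          (Ideal.mem_sup_right (Ideal.subset_span ⟨i, rfl⟩)), ?_, ?_⟩
        · refine natDegree_mul_le.trans ?_
          have := natDegree_linear_le (a := f i) (b := h i)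
          have := natDegree_X_pow_le (R := A) d
          omega
        · rw [coeff_mul_X_pow']
          simp
      | zero => exact ⟨0, Ideal.zero_mem _, by simp, by simp⟩
      | add x y _ _ hx hy =>
        obtain ⟨k, hk, hk1, hk2⟩ := hx
        obtain ⟨l, hl, hl1, hl2⟩ := hy
        exact ⟨k + l, Ideal.add_mem _ hk hl, natDegree_add_le_of_degree_le hk1 hl1, by simp [hk2, hl2]⟩
      | smul s x _ hx =>
        obtain ⟨k, hk, hk1, hk2⟩ := hx
        exact ⟨C s * k, Ideal.mul_mem_left _ _ hk, (natDegree_C_mul_le _ _).trans hk1, by simp [hk2]⟩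
    obtain ⟨k, hk, hk1, hk2⟩ := h2
    refine ⟨C a * X^(d+1) + k, Ideal.add_mem _ (Ideal.mul_mem_right _ _
      (Ideal.mem_sup_left (Ideal.mem_map_of_mem _ ha))) hk,
      natDegree_add_le_of_degree_le (natDegree_C_mul_X_pow_le _ _) hk1, by simp [hk2]⟩
  have main : ∀ (d : ℕ) (g : A[X]), g ∈ (bI N f h).radical → g.natDegree ≤ d → g ∈ bI N f h := by
    intro d
    induction d with
    | zero =>
      intro g hg hd
      rw [eq_C_of_natDegree_le_zero hd] at hg ⊢
      exact Ideal.mem_sup_left (Ideal.mem_map_of_mem _ (stepa _ hg))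
    | succ d ih =>
      intro g hg hd
      obtain ⟨k, hk, hk1, hk2⟩ := stepc d _ (stepb g d hg hd)
      have : g - k ∈ bI N f h := by
        apply ih _ (Ideal.sub_mem _ hg (Ideal.le_radical hk))
        rw [natDegree_le_iff_coeff_eq_zero]
        intro j hj
        rcases Nat.lt_or_ge (d+1) j with h1 | h1
        · rw [coeff_sub, coeff_eq_zero_of_natDegree_lt (lt_of_le_of_lt hd h1),
            coeff_eq_zero_of_natDegree_lt (lt_of_le_of_lt hk1 h1), sub_zero]
        · have : j = d + 1 := by omega
          subst this
          rw [coeff_sub, hk2, sub_self]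
      simpa using Ideal.add_mem _ this hk
  intro g hg
  exact main _ g hg le_rfl

end LemmaB
end Config


namespace Config

section Poly
open MvPolynomial
variable {K : Type} [Field K] {E : Type} [DecidableEq E]

/-- `p` does not involve `x_e` -/
def Fr (e : E) (p : MvPolynomial E K) : Prop := p ∈ supported K ({e}ᶜ : Set E)

lemma Fr.C (e : E) (c : K) : Fr e (C c : MvPolynomial E K) := (supported K _).algebraMap_mem c
lemma Fr.zero (e : E) : Fr e (0 : MvPolynomial E K) := (supported K _).zero_mem
lemma Fr.one (e : E) : Fr e (1 : MvPolynomial E K) := (supported K _).one_mem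
lemma Fr.add {e : E} {p q : MvPolynomial E K} (hp : Fr e p) (hq : Fr e q) : Fr e (p + q) :=
  (supported K _).add_mem hp hq
lemma Fr.mul {e : E} {p q : MvPolynomial E K} (hp : Fr e p) (hq : Fr e q) : Fr e (p * q) :=
  (supported K _).mul_mem hp hq
lemma Fr.neg {e : E} {p : MvPolynomial E K} (hp : Fr e p) : Fr e (-p) :=
  (supported K _).neg_mem hp
lemma Fr.sub {e : E} {p q : MvPolynomial E K} (hp : Fr e p) (hq : Fr e q) : Fr e (p - q) :=
  (supported K _).sub_mem hp hq
lemma Fr.sum {ι : Type*} {e : E} (s : Finset ι) (p : ι → MvPolynomial E K)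
    (hp : ∀ i ∈ s, Fr e (p i)) : Fr e (∑ i ∈ s, p i) := (supported K _).sum_mem hp
lemma Fr.X {e g : E} (h : g ≠ e) : Fr e (X g : MvPolynomial E K) :=
  X_mem_supported.2 (by simpa using h)

/-- substitution `x_e ↦ t` -/
noncomputable def sb (e : E) (t : Polynomial (MvPolynomial E K)) :
    MvPolynomial E K →ₐ[K] Polynomial (MvPolynomial E K) :=
  aeval (fun g => if g = e then t else Polynomial.C (X g))

lemma sb_X (e : E) (t : Polynomial (MvPolynomial E K)) : sb e t (X e) = t := by simp [sb]

lemma sb_Fr {e : E} (t : Polynomial (MvPolynomial E K)) {p : MvPolynomial E K} (hp : Fr e p) :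
    sb e t p = Polynomial.C p := by
  unfold Fr supported at hp
  induction hp using Algebra.adjoin_induction with
  | mem x hx =>
    obtain ⟨g, hg, rfl⟩ := hx
    have : g ≠ e := by simpa using hg
    simp [sb, this]
  | algebraMap r =>
    rw [AlgHom.commutes]
    rfl
  | add x y _ _ hx hy => rw [map_add, hx, hy, map_add]
  | mul x y _ _ hx hy => rw [map_mul, hx, hy, map_mul]

lemma sb_eval (e : E) (t : Polynomial (MvPolynomial E K)) (y : MvPolynomial E K)
    (h : t.eval y = X e) (p : MvPolynomial E K) : (sb e t p).eval y = p := by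
  have : ((Polynomial.evalRingHom y).comp (sb e t : MvPolynomial E K →+* _)) = RingHom.id _ := by
    apply MvPolynomial.ringHom_ext
    · intro r
      have : (sb e t) (MvPolynomial.C r) = Polynomial.C (MvPolynomial.C r) := sb_Fr t (Fr.C e r)
      simp [this]
    · intro g
      by_cases hg : g = e
      · subst hg; simp [sb, h]
      · simp [sb, hg]
  exact congrArg (fun f => f p) this

lemma lemBR {ι : Type*} (e : E) (N m : Ideal (MvPolynomial E K)) (f h : ι → MvPolynomial E K)
    (hN : N.IsRadical) (hm : m.IsRadical) (hm2 : m = N ⊔ Ideal.span (Set.range f))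
    (cross : ∀ i j, f i * h j - f j * h i ∈ N)
    (hmin : ∀ q ∈ N.minimalPrimes, ¬ m ≤ q)
    (hNf : ∃ G : Set (MvPolynomial E K), N = Ideal.span G ∧ ∀ p ∈ G, Fr e p)
    (hf : ∀ i, Fr e (f i)) (hh : ∀ i, Fr e (h i)) :
    (N ⊔ Ideal.span (Set.range fun i => X e * f i + h i)).IsRadical := by
  have hB := lemB N m f h hN hm hm2 cross hmin
  set I := (N ⊔ Ideal.span (Set.range fun i => X e * f i + h i)) with hI
  have h1 : I ≤ (bI N f h).comap (sb e Polynomial.X) := by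
    refine sup_le ?_ (Ideal.span_le.2 ?_)
    · obtain ⟨G, hG, hG2⟩ := hNf
      rw [hG, Ideal.span_le]
      intro p hp
      simp only [SetLike.mem_coe, Ideal.mem_comap]
      rw [sb_Fr _ (hG2 p hp)]
      refine Ideal.mem_sup_left (Ideal.mem_map_of_mem _ ?_)
      rw [← hG, hG]; exact Ideal.subset_span hp
    · rintro _ ⟨i, rfl⟩
      simp only [SetLike.mem_coe, Ideal.mem_comap]
      rw [map_add, map_mul, sb_X, sb_Fr _ (hf i), sb_Fr _ (hh i), mul_comm]
      exact Ideal.mem_sup_right (Ideal.subset_span ⟨i, rfl⟩)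
  have h2 : bI N f h ≤ I.comap (Polynomial.evalRingHom (X e)) := by
    apply bI_le
    · intro a ha
      simp only [Ideal.mem_comap, Polynomial.coe_evalRingHom, Polynomial.eval_C]
      exact Ideal.mem_sup_left ha
    · intro i
      simp only [Ideal.mem_comap, Polynomial.coe_evalRingHom, Polynomial.eval_C,
        Polynomial.eval_add, Polynomial.eval_mul, Polynomial.eval_X]
      rw [mul_comm]
      exact Ideal.mem_sup_right (Ideal.subset_span ⟨i, rfl⟩)
  intro g hg
  obtain ⟨n, hn⟩ := hg
  have h3 : sb e Polynomial.X g ∈ bI N f h := by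
    apply hB
    refine ⟨n, ?_⟩
    rw [← map_pow]
    exact h1 hn
  have := h2 h3
  simp only [Ideal.mem_comap, Polynomial.coe_evalRingHom] at this
  rwa [sb_eval _ _ _ (by simp)] at this

/-- translation-stable part of an ideal -/
noncomputable def TT (e : E) (P : Ideal (MvPolynomial E K)) : Ideal (MvPolynomial E K) :=
  (P.map Polynomial.C).comap (sb e (Polynomial.C (X e) + Polynomial.X))

lemma TT_prime (e : E) (P : Ideal (MvPolynomial E K)) [P.IsPrime] : (TT e P).IsPrime := by
  have : (P.map (Polynomial.C : MvPolynomial E K →+* _)).IsPrime := Ideal.isPrime_map_C_of_isPrime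
  exact Ideal.comap_isPrime _ _

lemma TT_le (e : E) (P : Ideal (MvPolynomial E K)) : TT e P ≤ P := by
  intro p hp
  have h1 := Ideal.mem_map_C_iff.1 (Ideal.mem_comap.1 hp) 0
  rwa [Polynomial.coeff_zero_eq_eval_zero, sb_eval _ _ _ (by simp)] at h1

lemma mem_TT_of_Fr {e : E} {P : Ideal (MvPolynomial E K)} {p : MvPolynomial E K} (hp : Fr e p)
    (h : p ∈ P) : p ∈ TT e P := by
  rw [TT, Ideal.mem_comap, sb_Fr _ hp]
  exact Ideal.mem_map_of_mem _ h

lemma coeff_mem_of_mem_TT {e : E} {P : Ideal (MvPolynomial E K)} {f h : MvPolynomial E K}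
    (hf : Fr e f) (hh : Fr e h) (hm : X e * f + h ∈ TT e P) : f ∈ P := by
  have h1 := Ideal.mem_map_C_iff.1 (Ideal.mem_comap.1 hm) 1
  rw [map_add, map_mul, sb_X, sb_Fr _ hf, sb_Fr _ hh, add_mul] at h1
  simpa [← map_mul, Polynomial.coeff_C] using h1

lemma X_notMem_TT (e : E) (P : Ideal (MvPolynomial E K)) (hP : P ≠ ⊤) : X e ∉ TT e P := by
  intro h
  apply hP
  rw [Ideal.eq_top_iff_one]
  apply coeff_mem_of_mem_TT (e := e) (Fr.one e) (Fr.zero e)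
  simpa using h

lemma span_le_TT {e : E} {P : Ideal (MvPolynomial E K)} {G : Set (MvPolynomial E K)}
    (hG : ∀ p ∈ G, Fr e p) (h : Ideal.span G ≤ P) : Ideal.span G ≤ TT e P := by
  rw [Ideal.span_le]
  intro p hp
  exact mem_TT_of_Fr (hG p hp) (h (Ideal.subset_span hp))

lemma TT_eq_of_minimal {e : E} {P : Ideal (MvPolynomial E K)} {G : Set (MvPolynomial E K)}
    (hG : ∀ p ∈ G, Fr e p) (h : P ∈ (Ideal.span G).minimalPrimes) : TT e P = P := by
  have := h.1.1
  exact le_antisymm (TT_le e P) (h.2 ⟨TT_prime e P, span_le_TT hG h.1.2⟩ (TT_le e P))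

/-- multi-affine polynomials with variables in `S` -/
inductive MA : Finset E → MvPolynomial E K → Prop
  | const (c : K) : MA ∅ (C c)
  | step (S : Finset E) (e : E) (he : e ∉ S) (f h : MvPolynomial E K) (hf : MA S f) (hh : MA S h) :
      MA (insert e S) (X e * f + h)

lemma MA.zero (S : Finset E) : MA S (0 : MvPolynomial E K) := by
  induction S using Finset.induction_on with
  | empty => simpa using MA.const (E := E) (0 : K)
  | insert e S he ih => simpa using MA.step S e he 0 0 ih ih

lemma MA.Fr {S : Finset E} {p : MvPolynomial E K} (h : MA S p) {e : E} (he : e ∉ S) : Fr e p := by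
  induction h with
  | const c => exact Fr.C _ _
  | step S g hg f h _ _ ih1 ih2 =>
    rw [Finset.mem_insert, not_or] at he
    exact ((Fr.X (fun hh => he.1 hh.symm)).mul (ih1 he.2)).add (ih2 he.2)

lemma MA.insert {S : Finset E} {p : MvPolynomial E K} (h : MA S p) (e : E) : MA (insert e S) p := by
  by_cases he : e ∈ S
  · rwa [Finset.insert_eq_of_mem he]
  · simpa using MA.step S e he 0 p (MA.zero S) h

lemma MA.mono {S T : Finset E} {p : MvPolynomial E K} (h : MA S p) (hST : S ⊆ T) : MA T p := by
  have : ∀ U : Finset E, MA (U ∪ S) p := by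
    intro U
    induction U using Finset.induction_on with
    | empty => simpa
    | insert e U he ih => rw [Finset.insert_union]; exact ih.insert e
  have := this T
  rwa [Finset.union_eq_left.2 hST] at this

lemma MA.smul {S : Finset E} {p : MvPolynomial E K} (hp : MA S p) (c : K) : MA S (C c * p) := by
  induction hp with
  | const d => rw [← C_mul]; exact MA.const _
  | step S e he f h _ _ ih1 ih2 =>
    have := MA.step S e he _ _ ih1 ih2
    convert this using 1; ring

lemma MA.neg {S : Finset E} {p : MvPolynomial E K} (hp : MA S p) : MA S (-p) := by
  have := hp.smul (-1)
  simpa using this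

lemma MA.decomp {S : Finset E} {p : MvPolynomial E K} (hp : MA S p) {e : E} (he : e ∈ S) :
    ∃ f h, MA (S.erase e) f ∧ MA (S.erase e) h ∧ p = X e * f + h := by
  induction hp with
  | const c => exact absurd he (Finset.notMem_empty e)
  | step S g hg f h hf hh ih1 ih2 =>
    by_cases heg : e = g
    · subst heg
      rw [Finset.erase_insert hg]
      exact ⟨f, h, hf, hh, rfl⟩
    · have heS : e ∈ S := by simpa [heg] using he
      obtain ⟨f1, f2, a1, a2, rfl⟩ := ih1 heS
      obtain ⟨h1, h2, b1, b2, rfl⟩ := ih2 heS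
      have hgS : g ∉ S.erase e := fun h => hg (Finset.mem_of_mem_erase h)
      rw [Finset.erase_insert_of_ne (Ne.symm heg)]
      refine ⟨X g * f1 + h1, X g * f2 + h2, MA.step _ _ hgS _ _ a1 b1, MA.step _ _ hgS _ _ a2 b2, ?_⟩
      ring

lemma MA.eq_C {p : MvPolynomial E K} (hp : MA ∅ p) : ∃ c, p = C c := by
  generalize hS : (∅ : Finset E) = S at hp
  cases hp with
  | const c => exact ⟨c, rfl⟩
  | step S e he f h _ _ => exact absurd hS.symm (Finset.insert_ne_empty _ _)

lemma MA.add {S : Finset E} {p q : MvPolynomial E K} (hp : MA S p) (hq : MA S q) : MA S (p + q) := by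
  induction hp generalizing q with
  | const c =>
    obtain ⟨d, rfl⟩ := hq.eq_C
    rw [← MvPolynomial.C_add]
    exact MA.const _
  | step S e he f h _ _ ih1 ih2 =>
    obtain ⟨f', h', hf', hh', rfl⟩ := hq.decomp (Finset.mem_insert_self e S)
    rw [Finset.erase_insert he] at hf' hh'
    have := MA.step S e he _ _ (ih1 hf') (ih2 hh')
    convert this using 1
    ring

lemma decomp_unique {e : E} {f h f' h' : MvPolynomial E K} (hf : Fr e f) (hh : Fr e h)
    (hf' : Fr e f') (hh' : Fr e h') (heq : X e * f + h = X e * f' + h') : f = f' ∧ h = h' := by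
  have h1 := congrArg (sb e Polynomial.X) heq
  rw [map_add, map_add, map_mul, map_mul, sb_X, sb_Fr _ hf, sb_Fr _ hh, sb_Fr _ hf', sb_Fr _ hh'] at h1
  constructor
  · have := congrArg (fun p => Polynomial.coeff p 1) h1
    simpa [Polynomial.coeff_C] using this
  · have := congrArg (fun p => Polynomial.coeff p 0) h1
    simpa [Polynomial.coeff_C] using this

lemma lemC {S : Finset E} {p : MvPolynomial E K} (hp : MA S p) (P : Ideal (MvPolynomial E K))
    (hP : P ≠ ⊤) (hT : ∀ e ∈ S, TT e P = P) (hm : p ∈ P) : p = 0 := by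
  induction hp with
  | const c =>
    by_contra hc
    have hc' : c ≠ 0 := fun h => hc (by rw [h, map_zero])
    apply hP
    exact Ideal.eq_top_of_isUnit_mem _ hm ((isUnit_iff_ne_zero.2 hc').map C)
  | step S e he f h hf hh ih1 ih2 =>
    have hf1 : f ∈ P := by
      apply coeff_mem_of_mem_TT (hf.Fr he) (hh.Fr he)
      rwa [hT e (Finset.mem_insert_self _ _)]
    have hh1 : h ∈ P := (Ideal.add_mem_iff_right _ (Ideal.mul_mem_left _ _ hf1)).1 hm
    rw [ih1 (fun e he => hT e (Finset.mem_insert_of_mem he)) hf1,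
      ih2 (fun e he => hT e (Finset.mem_insert_of_mem he)) hh1]
    simp

lemma MA.span_radical {S : Finset E} {p : MvPolynomial E K} (hp : MA S p) :
    (Ideal.span {p}).IsRadical := by
  induction hp with
  | const c =>
    by_cases hc : c = 0
    · subst hc
      simp only [map_zero]
      rw [Ideal.span_singleton_eq_bot.2 rfl]
      exact Ideal.isPrime_bot.isRadical
    · rw [Ideal.span_singleton_eq_top.2 ((isUnit_iff_ne_zero.2 hc).map C)]
      intro x _; trivial
  | step S e he f h hf hh ih1 ih2 =>
    by_cases hf0 : f = 0
    · subst hf0; simpa using ih2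
    · have := lemBR (ι := Unit) e ⊥ (Ideal.span {f}) (fun _ => f) (fun _ => h)
        Ideal.isPrime_bot.isRadical ih1 (by simp) (by simp) (by
          intro q hq hle
          have hq0 : q = ⊥ := by
            have := hq.2 ⟨Ideal.isPrime_bot, le_rfl⟩ bot_le
            exact le_bot_iff.1 this
          subst hq0
          rw [Ideal.span_singleton_le_iff_mem, Ideal.mem_bot] at hle
          exact hf0 hle) ⟨∅, by simp, by simp⟩ (fun _ => hf.Fr he) (fun _ => hh.Fr he)
      simpa using this

lemma MA.span_pair_radical {S T : Finset E} {p q : MvPolynomial E K} (hp : MA S p) (hq : MA T q)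
    (hST : Disjoint S T) : (Ideal.span {p, q}).IsRadical := by
  induction hp with
  | const c =>
    by_cases hc : c = 0
    · subst hc
      rw [map_zero, Ideal.span_insert_zero]
      exact hq.span_radical
    · rw [Ideal.eq_top_of_isUnit_mem _ (Ideal.subset_span (Set.mem_insert _ _))
        ((isUnit_iff_ne_zero.2 hc).map C)]
      intro x _; trivial
  | step S e he f h hf hh ih1 ih2 =>
    rw [Finset.disjoint_insert_left] at hST
    by_cases hf0 : f = 0
    · subst hf0; simpa using ih2 hST.2
    · have hsp : ∀ f : MvPolynomial E K, Ideal.span {f, q} = Ideal.span {q} ⊔ Ideal.span {f} := by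
        intro f
        rw [Ideal.span_insert, sup_comm]
      have := lemBR (ι := Unit) e (Ideal.span {q}) (Ideal.span {f, q}) (fun _ => f) (fun _ => h)
        hq.span_radical (ih1 hST.2) (by simp [hsp]) (by simp) (by
          intro Q hQ hle
          refine hf0 (lemC hf Q hQ.1.1.ne_top ?_ (hle (Ideal.subset_span (Set.mem_insert _ _))))
          intro g hg
          refine TT_eq_of_minimal ?_ hQ
          intro p hp
          rw [Set.mem_singleton_iff.1 hp]
          exact hq.Fr (Finset.disjoint_left.1 hST.2 hg))
        ⟨{q}, rfl, by
          intro p hp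
          rw [Set.mem_singleton_iff.1 hp]
          exact hq.Fr hST.1⟩ (fun _ => hf.Fr he) (fun _ => hh.Fr he)
      rw [hsp]
      simpa using this

/-- graded criterion -/
lemma graded_radical (I : Ideal (MvPolynomial E K)) (e : E) 
    (hI : ∃ G : Set (MvPolynomial E K), I = Ideal.span G ∧ ∀ p ∈ G, ∃ n, p.IsHomogeneous n)
    (h1 : (I ⊔ Ideal.span {X e}).IsRadical)
    (h2 : ∀ P ∈ I.minimalPrimes, X e ∉ P) : I.IsRadical := by
  classical
  let _ : GradedAlgebra (homogeneousSubmodule E K) := MvPolynomial.gradedAlgebra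
  replace hI : I.IsHomogeneous (homogeneousSubmodule E K) := by
    obtain ⟨G, rfl, hG⟩ := hI
    exact Ideal.homogeneous_span _ _ hG
  have hR : I.radical.IsHomogeneous (homogeneousSubmodule E K) := hI.radical
  have hle : I.radical ≤ I ⊔ Ideal.span {X e} :=
    (Ideal.radical_mono le_sup_left).trans h1.radical.le
  have hx : ∀ g, X e * g ∈ I.radical → g ∈ I.radical := by
    intro g hg
    rw [← Ideal.sInf_minimalPrimes, Ideal.mem_sInf] at hg ⊢
    intro P hP
    exact (hP.1.1.mem_or_mem (hg hP)).resolve_left (h2 P hP)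
  have key : ∀ n g, g ∈ homogeneousSubmodule E K n → g ∈ I.radical → g ∈ I := by
    intro n
    induction n with
    | zero =>
      intro g hg hgr
      obtain ⟨i, hi, j, hj, hij⟩ := Submodule.mem_sup.1 (hle hgr)
      obtain ⟨g', rfl⟩ := Ideal.mem_span_singleton'.1 hj
      have hd := congrArg (fun p => ((DirectSum.decompose (homogeneousSubmodule E K) p 0 : MvPolynomial E K))) hij
      simp only [DirectSum.decompose_add, DirectSum.add_apply, Submodule.coe_add] at hd
      rw [DirectSum.decompose_of_mem_same _ hg, mul_comm,
        DirectSum.coe_decompose_mul_of_left_mem_of_not_le _ (i := 1) (isHomogeneous_X K e) (by omega),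
        add_zero] at hd
      rw [← hd]
      exact hI 0 hi
    | succ n ih =>
      intro g hg hgr
      obtain ⟨i, hi, j, hj, hij⟩ := Submodule.mem_sup.1 (hle hgr)
      obtain ⟨g', rfl⟩ := Ideal.mem_span_singleton'.1 hj
      have hd := congrArg (fun p => ((DirectSum.decompose (homogeneousSubmodule E K) p (n+1) : MvPolynomial E K))) hij
      simp only [DirectSum.decompose_add, DirectSum.add_apply, Submodule.coe_add] at hd
      rw [DirectSum.decompose_of_mem_same _ hg, mul_comm,
        DirectSum.coe_decompose_mul_of_left_mem_of_le _ (i := 1) (isHomogeneous_X K e) (by omega)] at hd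
      have hi' := hI (n+1) hi
      rw [← hd]
      refine Ideal.add_mem _ hi' (Ideal.mul_mem_left _ _ ?_)
      apply ih
      · exact SetLike.coe_mem _
      · apply hx
        have : X e * ((DirectSum.decompose (homogeneousSubmodule E K) g' n : MvPolynomial E K)) =
          g - (DirectSum.decompose (homogeneousSubmodule E K) i (n+1) : MvPolynomial E K) := by
          rw [← hd]; simp
        change X e * ((DirectSum.decompose (homogeneousSubmodule E K) g' n : MvPolynomial E K)) ∈ _
        rw [this]
        exact Ideal.sub_mem _ hgr (Ideal.le_radical hi')
  intro g hg
  rw [← DirectSum.sum_support_decompose (homogeneousSubmodule E K) g]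
  exact Ideal.sum_mem _ fun n _ => key n _ (SetLike.coe_mem _) (hR n hg)

lemma TT_height {e : E} [Finite E] {P : Ideal (MvPolynomial E K)} [P.IsPrime] (n : ℕ) (h : TT e P ≠ P)
    (hn : (n : ℕ∞) ≤ (TT e P).height) : ((n+1 : ℕ) : ℕ∞) ≤ P.height := by
  have := TT_prime e P
  have h1 := Ideal.height_add_one_le_of_lt_of_isPrime (lt_of_le_of_ne (TT_le e P) h)
  push_cast
  exact le_trans (by gcongr) h1

end Poly
end Config


namespace Config

section States
open MvPolynomial Matrix

/-- a symmetric matrix together with vectors indexed by `E` -/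
structure St (K E : Type) [Field K] where
  ι : Type
  [fι : Fintype ι]
  [dι : DecidableEq ι]
  Z : Matrix ι ι K
  symm : Z.IsSymm
  v : E → ι → K

attribute [instance] St.fι St.dι

variable {K : Type} [Field K] {E : Type} [DecidableEq E]

namespace St
variable (σ : St K E)

/-- vectors over the polynomial ring -/
noncomputable def vv (e : E) : σ.ι → MvPolynomial E K := C ∘ σ.v e

/-- the symmetric matrix -/
noncomputable def ZZ (S : Finset E) : Matrix σ.ι σ.ι (MvPolynomial E K) :=
  σ.Z.map C + ∑ e ∈ S, (X e : MvPolynomial E K) • vecMulVec (σ.vv e) (σ.vv e)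

/-- its determinant -/
noncomputable def ps (S : Finset E) : MvPolynomial E K := (σ.ZZ S).det

/-- adjugate entries -/
noncomputable def a (S : Finset E) (f g : E) : MvPolynomial E K := af (σ.ZZ S) (σ.vv f) (σ.vv g)

/-- second order entries -/
noncomputable def B (S : Finset E) (q u p v : E) : MvPolynomial E K :=
  bf (σ.ZZ S) (σ.vv q) (σ.vv u) (σ.vv p) (σ.vv v)

/-- contraction -/
def con (e : E) : St K E where
  ι := σ.ι ⊕ Unit
  Z := border σ.Z (σ.v e) (σ.v e)
  symm := by
    ext i j
    rcases i with i | i <;> rcases j with j | j <;> simp [border, σ.symm.apply]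
  v f := ext0 (σ.v f)

lemma ZZ_symm (S : Finset E) : (σ.ZZ S).IsSymm := by
  refine Matrix.ext fun i j => ?_
  simp only [ZZ, transpose_apply, Matrix.add_apply, Matrix.map_apply, Matrix.sum_apply,
    Matrix.smul_apply, vecMulVec_apply, σ.symm.apply i j]
  congr 1
  apply Finset.sum_congr rfl
  intro e _
  rw [mul_comm (σ.vv e j)]

lemma ZZ_insert {S : Finset E} {e : E} (he : e ∉ S) :
    σ.ZZ (insert e S) = σ.ZZ S + (X e : MvPolynomial E K) • vecMulVec (σ.vv e) (σ.vv e) := by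
  rw [ZZ, Finset.sum_insert he, ZZ]
  abel

lemma con_vv (e f : E) : (σ.con e).vv f = ext0 (σ.vv f) := ext0_map C (σ.v f)

lemma con_ZZ (e : E) (S : Finset E) : (σ.con e).ZZ S = border (σ.ZZ S) (σ.vv e) (σ.vv e) := by
  induction S using Finset.induction_on with
  | empty =>
    simp only [ZZ, Finset.sum_empty, add_zero]
    exact border_map C σ.Z (σ.v e) (σ.v e)
  | insert g S hg ih =>
    rw [ZZ_insert _ hg, ZZ_insert _ hg, ih, border_add, con_vv]
    rfl

lemma con_ps (e : E) (S : Finset E) : (σ.con e).ps S = - σ.a S e e := by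
  rw [ps, con_ZZ]
  exact det_border _ _ _

lemma con_a (e f g : E) (S : Finset E) : (σ.con e).a S f g = - σ.B S e f e g := by
  unfold a B bf
  rw [con_ZZ, con_vv, con_vv, neg_neg]
  rfl

lemma a_symm (S : Finset E) (f g : E) : σ.a S f g = σ.a S g f := af_symm _ (σ.ZZ_symm S) _ _

lemma ps_mul_B (S : Finset E) (q u p v : E) :
    σ.ps S * σ.B S q u p v = σ.a S q p * σ.a S u v - σ.a S u p * σ.a S q v := det_mul_bf _ _ _ _ _

lemma B_anti_left (S : Finset E) (q u p v : E) : σ.B S q u p v = - σ.B S u q p v :=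
  bf_anti_left _ _ _ _ _
lemma B_anti_right (S : Finset E) (q u p v : E) : σ.B S q u p v = - σ.B S q u v p :=
  bf_anti_right _ _ _ _ _
lemma B_transpose (S : Finset E) (q u p v : E) : σ.B S q u p v = σ.B S p v q u :=
  bf_transpose _ (σ.ZZ_symm S) _ _ _ _
lemma B_self_left (S : Finset E) (q p v : E) : σ.B S q q p v = 0 := bf_self_left _ _ _ _
lemma B_self_right (S : Finset E) (q u p : E) : σ.B S q u p p = 0 := by
  rw [B_transpose, B_self_left]

lemma B_insert {S : Finset E} {e : E} (he : e ∉ S) (f g : E) :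
    σ.B (insert e S) e f e g = σ.B S e f e g := by
  unfold B
  rw [ZZ_insert _ he]
  exact bf_add_rank_one _ _ _ _ _ _

lemma B_erase {S : Finset E} (e : E) (f g : E) :
    σ.B S e f e g = σ.B (S.erase e) e f e g := by
  by_cases he : e ∈ S
  · conv_lhs => rw [← Finset.insert_erase he]
    rw [B_insert _ (Finset.notMem_erase e S)]
  · rw [Finset.erase_eq_of_notMem he]

lemma ps_insert {S : Finset E} {e : E} (he : e ∉ S) :
    σ.ps (insert e S) = X e * σ.a S e e + σ.ps S := by
  unfold ps
  rw [ZZ_insert _ he, det_rank_one, add_comm]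
  rfl

lemma a_insert {S : Finset E} {e : E} (he : e ∉ S) (f g : E) :
    σ.a (insert e S) f g = X e * σ.B S e f e g + σ.a S f g := by
  have : σ.B S e f e g = σ.B S f e g e := by
    rw [B_anti_left, B_anti_right, neg_neg]
  rw [this]
  unfold a
  rw [ZZ_insert _ he, af_rank_one, add_comm]
  rfl

lemma a_erase (S : Finset E) (e g : E) : σ.a S e g = σ.a (S.erase e) e g := by
  by_cases he : e ∈ S
  · conv_lhs => rw [← Finset.insert_erase he]
    rw [a_insert _ (Finset.notMem_erase e S), B_self_left]
    simp
  · rw [Finset.erase_eq_of_notMem he]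

lemma a_decomp {S : Finset E} {e : E} (he : e ∈ S) (f g : E) :
    σ.a S f g = X e * σ.B S e f e g + σ.a (S.erase e) f g := by
  conv_lhs => rw [← Finset.insert_erase he]
  rw [a_insert _ (Finset.notMem_erase e S), ← B_erase]

lemma ps_decomp {S : Finset E} {e : E} (he : e ∈ S) :
    σ.ps S = X e * σ.a S e e + σ.ps (S.erase e) := by
  conv_lhs => rw [← Finset.insert_erase he]
  rw [ps_insert _ (Finset.notMem_erase e S), ← a_erase]

lemma MA_aux (S : Finset E) : ∀ σ : St K E, MA S (σ.ps S) ∧ ∀ f g, MA S (σ.a S f g) := by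
  induction S using Finset.induction_on with
  | empty =>
    intro σ
    constructor
    · have : σ.ps ∅ = C σ.Z.det := by
        simp only [ps, ZZ, Finset.sum_empty, add_zero]
        exact (RingHom.map_det C σ.Z).symm
      rw [this]
      exact MA.const _
    · intro f g
      have : σ.a ∅ f g = C (af σ.Z (σ.v f) (σ.v g)) := by
        simp only [a, ZZ, Finset.sum_empty, add_zero]
        exact (af_map C σ.Z _ _).symm
      rw [this]
      exact MA.const _
  | insert e S he ih =>
    intro σ
    constructor
    · rw [ps_insert _ he]
      exact MA.step _ _ he _ _ ((ih σ).2 _ _) (ih σ).1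
    · intro f g
      rw [a_insert _ he]
      refine MA.step _ _ he _ _ ?_ ((ih σ).2 _ _)
      have := ((ih (σ.con e)).2 f g).neg
      rwa [con_a, neg_neg] at this

lemma MA_ps (S : Finset E) : MA S (σ.ps S) := (MA_aux S σ).1
lemma MA_a (S : Finset E) (f g : E) : MA S (σ.a S f g) := (MA_aux S σ).2 f g
lemma MA_a' (S : Finset E) (f g : E) : MA (S.erase f) (σ.a S f g) := by
  rw [a_erase]; exact σ.MA_a _ _ _
lemma MA_a'' (S : Finset E) (f g : E) : MA ((S.erase f).erase g) (σ.a S f g) := by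
  rw [a_erase, a_symm, a_erase]; exact σ.MA_a _ _ _
lemma MA_B (S : Finset E) (e f g : E) : MA (S.erase e) (σ.B S e f e g) := by
  rw [B_erase]
  have := ((σ.con e).MA_a (S.erase e) f g).neg
  rwa [con_a, neg_neg] at this
lemma Fr_a (S : Finset E) (f g : E) : Fr f (σ.a S f g) := (σ.MA_a' S f g).Fr (Finset.notMem_erase _ _)
lemma Fr_a_right (S : Finset E) (f g : E) : Fr g (σ.a S f g) := by
  rw [a_symm]; exact σ.Fr_a _ _ _
lemma Fr_B (S : Finset E) (e f g : E) : Fr e (σ.B S e f e g) :=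
  (σ.MA_B S e f g).Fr (Finset.notMem_erase _ _)
lemma Fr_a_erase (S : Finset E) (e f g : E) : Fr e (σ.a (S.erase e) f g) :=
  (σ.MA_a _ f g).Fr (Finset.notMem_erase _ _)
lemma Fr_ps_erase (S : Finset E) (e : E) : Fr e (σ.ps (S.erase e)) :=
  (σ.MA_ps _).Fr (Finset.notMem_erase _ _)

/-- homogeneity -/
def Hom (d : ℕ) : Prop := (∀ S, (σ.ps S).IsHomogeneous d) ∧
  (∀ S f g, (σ.a S f g).IsHomogeneous (d - 1)) ∧ (d = 0 → ∀ S f g, σ.a S f g = 0)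

lemma weight_one_single (e : E) : (Finsupp.weight (1 : E → ℕ)) (Finsupp.single e 1) = 1 := by
  rw [Finsupp.weight_single]; rfl

lemma homog_of_X_mul {e : E} {p : MvPolynomial E K} {d : ℕ} (h : (X e * p).IsHomogeneous (d+1)) :
    p.IsHomogeneous d := by
  intro m hm
  have h1 : coeff (m + Finsupp.single e 1) (X e * p) ≠ 0 := by
    rw [mul_comm, coeff_mul_X]; exact hm
  have h2 := h h1
  rw [map_add, weight_one_single] at h2
  omega

lemma zero_of_X_mul {e : E} {p : MvPolynomial E K} (h : (X e * p).IsHomogeneous 0) : p = 0 := by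
  ext m
  rw [coeff_zero]
  by_contra hm
  have h1 : coeff (m + Finsupp.single e 1) (X e * p) ≠ 0 := by
    rw [mul_comm, coeff_mul_X]; exact hm
  have h2 := h h1
  rw [map_add, weight_one_single] at h2
  omega

variable {σ}

lemma Hom.con {d : ℕ} (h : σ.Hom d) (e : E) : (σ.con e).Hom (d - 1) := by
  have hX : ∀ S f g, (X e * σ.B S e f e g).IsHomogeneous (d - 1) := by
    intro S f g
    have h1 := h.2.1 (insert e (S.erase e)) f g
    rw [a_insert _ (Finset.notMem_erase e S)] at h1
    have h2 := h1.sub (h.2.1 (S.erase e) f g)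
    rw [B_erase]
    simpa using h2
  refine ⟨?_, ?_, ?_⟩
  · intro S
    rw [con_ps]
    exact (h.2.1 S e e).neg
  · intro S f g
    rw [con_a]
    apply IsHomogeneous.neg
    rcases Nat.eq_zero_or_pos (d - 1) with h0 | h0
    · have := hX S f g
      rw [h0] at this
      rw [zero_of_X_mul this]
      exact isHomogeneous_zero _ _ _
    · apply homog_of_X_mul (e := e)
      rw [Nat.sub_add_cancel h0]
      exact hX S f g
  · intro h0 S f g
    have := hX S f g
    rw [h0] at this
    rw [con_a, zero_of_X_mul this, neg_zero]

lemma eq_zero_of_homog {p : MvPolynomial E K} {m n : ℕ} (hm : p.IsHomogeneous m)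
    (hn : p.IsHomogeneous n) (h : m ≠ n) : p = 0 := by
  by_contra h0
  exact h (hm.inj_right hn h0)

lemma loop (S : Finset E) : ∀ (σ : St K E) (d : ℕ), σ.Hom d → ∀ e f, σ.a S e e = 0 → σ.a S e f = 0 := by
  induction S using Finset.induction_on with
  | empty =>
    intro σ d h e f he
    by_cases hd : d = 1
    · have hps : σ.ps ∅ = 0 := by
        obtain ⟨c, hc⟩ := (σ.MA_ps ∅).eq_C
        have h1 := h.1 ∅
        rw [hc, hd] at h1
        rw [hc]
        exact eq_zero_of_homog (isHomogeneous_C _ _) h1 (by norm_num)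
      have := σ.ps_mul_B ∅ e f e f
      rw [hps, he, zero_mul, zero_mul, zero_sub, σ.a_symm _ f e] at this
      simpa using this.symm
    · by_cases hd0 : d = 0
      · exact h.2.2 hd0 _ _ _
      · obtain ⟨c, hc⟩ := (σ.MA_a ∅ e f).eq_C
        have h1 := h.2.1 ∅ e f
        rw [hc] at h1 ⊢
        exact eq_zero_of_homog (isHomogeneous_C _ _) h1 (by omega)
  | insert g S hg ih =>
    intro σ d h e f he
    have hF : ∀ f f', Fr g (σ.B S g f g f') := fun f f' => σ.Fr_B S g f f'
    have hF2 : ∀ f f', Fr g (σ.a S f f') := fun f f' => (σ.MA_a S f f').Fr hg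
    rw [a_insert _ hg] at he ⊢
    have h2 := decomp_unique (hF _ _) (hF2 _ _) (Fr.zero g) (Fr.zero g)
      (by rw [he]; simp : X g * σ.B S g e g e + σ.a S e e = X g * 0 + 0)
    have h3 := ih σ d h e f h2.2
    have h4 := ih (σ.con g) _ (h.con g) e f (by rw [con_a, h2.1, neg_zero])
    rw [con_a, neg_eq_zero] at h4
    rw [h3, h4]; simp

lemma coloop {S : Finset E} {d : ℕ} (h : σ.Hom d) {e f : E} (hf : f ∈ S) (hef : f ≠ e)
    (h0 : σ.ps (S.erase e) = 0) : σ.a S e f = 0 := by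
  have hf' : f ∈ S.erase e := by simp [hf, hef]
  rw [σ.ps_decomp hf'] at h0
  have h2 := decomp_unique (σ.Fr_a _ _ _) (σ.Fr_ps_erase _ _) (Fr.zero f) (Fr.zero f)
    (by rw [h0]; simp : _ = X f * 0 + 0)
  have := loop _ σ d h f e h2.1
  rw [a_erase, a_symm, this]

lemma trans_a {S : Finset E} (h0 : σ.ps S ≠ 0) {e f g : E} (hg : g ∈ S) (h : σ.a S e f = 0) :
    σ.a S e g = 0 ∨ σ.a S g f = 0 := by
  have h1 := h
  rw [σ.a_decomp hg] at h1
  have h2 := decomp_unique (σ.Fr_B _ _ _ _) (σ.Fr_a_erase _ _ _ _) (Fr.zero g) (Fr.zero g)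
    (by rw [h1]; simp : _ = X g * 0 + 0)
  have h3 := σ.ps_mul_B S g e g f
  rw [h2.1, h] at h3
  rw [← mul_eq_zero]
  linear_combination h3

lemma exists_sep {ι : Type} [Fintype ι] [DecidableEq ι] (U : Submodule K (ι → K)) (v : ι → K) (h : v ∉ U) :
    ∃ κ : ι → K, v ⬝ᵥ κ = 1 ∧ ∀ u ∈ U, u ⬝ᵥ κ = 0 := by
  obtain ⟨φ, h1, h2⟩ := Submodule.exists_le_ker_of_notMem h
  have key : ∀ u : ι → K, φ u = u ⬝ᵥ fun i => φ (Pi.single i 1) := by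
    intro u
    conv_lhs => rw [pi_eq_sum_univ' u]
    rw [map_sum]
    simp only [dotProduct]
    refine Finset.sum_congr rfl fun i _ => ?_
    rw [map_smul, smul_eq_mul]
  refine ⟨(φ v)⁻¹ • fun i => φ (Pi.single i 1), ?_, ?_⟩
  · rw [dotProduct_smul, ← key, smul_eq_mul, inv_mul_cancel₀ h1]
  · intro u hu
    rw [dotProduct_smul, ← key, h2 hu, smul_zero]

lemma C_dot {ι : Type} [Fintype ι] (u v : ι → K) :
    (C (u ⬝ᵥ v) : MvPolynomial E K) = (C ∘ u) ⬝ᵥ (C ∘ v) := by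
  simp [dotProduct]

lemma af_lin {A : Type} [CommRing A] {n : Type} [Fintype n] [DecidableEq n] (M : Matrix n n A) (x y : n → A)
    (T : Finset E) (c : E → A) (u : E → n → A) :
    af M x (y + ∑ f ∈ T, c f • u f) = af M x y + ∑ f ∈ T, c f * af M x (u f) := by
  simp only [af, Matrix.mulVec_add, dotProduct_add, Matrix.mulVec_sum, dotProduct_sum, Matrix.mulVec_smul,
    dotProduct_smul, smul_eq_mul]

lemma gen (μ : σ.ι → K) (T : Finset E) (g : E) :
      σ.ps T * C (σ.v g ⬝ᵥ μ) = af (σ.ZZ T) (σ.vv g) (C ∘ (σ.Z *ᵥ μ)) +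
        ∑ f ∈ T, X f * C (σ.v f ⬝ᵥ μ) * σ.a T f g := by
  have h1 : σ.ZZ T *ᵥ (C ∘ μ) = C ∘ (σ.Z *ᵥ μ) +
      ∑ f ∈ T, (X f * C (σ.v f ⬝ᵥ μ) : MvPolynomial E K) • σ.vv f := by
    rw [ZZ, Matrix.add_mulVec, Matrix.sum_mulVec]
    congr 1
    · ext1 i
      simp [Matrix.mulVec, dotProduct]
    · apply Finset.sum_congr rfl
      intro f _
      rw [Matrix.smul_mulVec, Matrix.vecMulVec_mulVec, C_dot, mul_smul]
      congr 1
      ext1 i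
      simp [vv, mul_comm]
  have h2 : σ.ps T * C (σ.v g ⬝ᵥ μ) = af (σ.ZZ T) (σ.vv g) (σ.ZZ T *ᵥ (C ∘ μ)) := by
    rw [af, Matrix.mulVec_mulVec, Matrix.adjugate_mul, Matrix.smul_mulVec, Matrix.one_mulVec,
      dotProduct_smul, C_dot]
    rfl
  rw [h2, h1, af_lin]
  have h5 : ∀ f, af (σ.ZZ T) (σ.vv g) (σ.vv f) = σ.a T f g := fun f => σ.a_symm T g f
  simp only [h5]

lemma gen_homog {d : ℕ} (h : σ.Hom d) (μ : σ.ι → K) (T : Finset E) (g : E) :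
    (af (σ.ZZ T) (σ.vv g) (C ∘ (σ.Z *ᵥ μ))).IsHomogeneous d := by
  have h3 : af (σ.ZZ T) (σ.vv g) (C ∘ (σ.Z *ᵥ μ)) =
      σ.ps T * C (σ.v g ⬝ᵥ μ) - ∑ f ∈ T, X f * C (σ.v f ⬝ᵥ μ) * σ.a T f g := by
    rw [gen]; ring
  rw [h3]
  apply IsHomogeneous.sub
  · simpa using (h.1 T).mul (isHomogeneous_C E (σ.v g ⬝ᵥ μ))
  · apply IsHomogeneous.sum
    intro f _
    by_cases hd0 : d = 0
    · rw [h.2.2 hd0, mul_zero]; exact isHomogeneous_zero _ _ _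
    have := ((isHomogeneous_X K f).mul (isHomogeneous_C E (σ.v f ⬝ᵥ μ))).mul (h.2.1 T f g)
    rwa [show 1 + 0 + (d - 1) = d by omega] at this

lemma range_sep (v : σ.ι → K) (κ : σ.ι → K) (hκ : ∀ u, (σ.Z *ᵥ u) ⬝ᵥ κ = 0) : σ.Z *ᵥ κ = 0 := by
  ext i
  have := hκ (Pi.single i 1)
  rw [dotProduct_comm, dotProduct_mulVec, ← Matrix.mulVec_transpose, σ.symm.eq] at this
  simpa using this

/-- κ -/
lemma kappa {S : Finset E} {d : ℕ} (h : σ.Hom d) {e : E} (he : σ.a S e e ≠ 0) :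
    ∃ κ : E → K, κ e = 1 ∧ ∀ T g, σ.ps T * C (κ g) = ∑ f ∈ T, X f * C (κ f) * σ.a T f g := by
  have hd0 : d ≠ 0 := fun h0 => he (h.2.2 h0 _ _ _)
  by_cases hex : σ.v e ∈ LinearMap.range (Matrix.mulVecLin σ.Z)
  · exfalso
    obtain ⟨μ, hμ⟩ := hex
    have h2 := gen_homog h μ S e
    rw [Matrix.mulVecLin_apply] at hμ
    rw [hμ] at h2
    exact he (eq_zero_of_homog h2 (h.2.1 S e e) (by omega))
  · obtain ⟨κ, h1, h2⟩ := exists_sep _ _ hex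
    have h3 : σ.Z *ᵥ κ = 0 := range_sep (σ.v e) κ fun u => h2 _ ⟨u, rfl⟩
    refine ⟨fun f => σ.v f ⬝ᵥ κ, h1, fun T g => ?_⟩
    rw [gen, h3]
    simp [af]

/-- spanning -/
lemma spanning {T : Finset E} {d : ℕ} (h : σ.Hom d) (hT : σ.ps T ≠ 0) (e : E) :
    ∃ c : E → K, ∀ g, σ.a T e g = ∑ f ∈ T, C (c f) * σ.a T f g := by
  by_cases hd0 : d = 0
  · exact ⟨0, fun g => by simp [h.2.2 hd0]⟩
  by_cases hex : σ.v e ∈ LinearMap.range (Matrix.mulVecLin σ.Z) ⊔ Submodule.span K (σ.v '' T)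
  · obtain ⟨u, hu, y, hy, huy⟩ := Submodule.mem_sup.1 hex
    obtain ⟨μ, hμ⟩ := hu
    rw [Matrix.mulVecLin_apply] at hμ
    obtain ⟨c', hc'⟩ := (Submodule.mem_span_image_finset_iff_exists_fun K).1 hy
    obtain ⟨c, hc⟩ : ∃ c : E → K, ∑ i ∈ T, c i • σ.v i = y := by
      refine ⟨fun f => if h : f ∈ T then c' ⟨f, h⟩ else 0, ?_⟩
      rw [← hc', ← Finset.sum_coe_sort]
      simp
    refine ⟨c, fun g => ?_⟩
    have h1 : σ.vv e = C ∘ (σ.Z *ᵥ μ) + ∑ f ∈ T, (C (c f) : MvPolynomial E K) • σ.vv f := by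
      rw [hμ]
      ext1 i
      have := congrFun huy i
      rw [← hc] at this
      simp only [vv, Function.comp, ← this, Pi.add_apply, Finset.sum_apply, Pi.smul_apply, smul_eq_mul,
        map_add, map_sum, map_mul]
    have h2 : σ.a T e g = af (σ.ZZ T) (σ.vv g) (C ∘ (σ.Z *ᵥ μ)) + ∑ f ∈ T, C (c f) * σ.a T f g := by
      rw [a_symm, a, h1, af_lin]
      have h5 : ∀ f, af (σ.ZZ T) (σ.vv g) (σ.vv f) = σ.a T f g := fun f => σ.a_symm T g f
      simp only [h5]
    have h3 : (af (σ.ZZ T) (σ.vv g) (C ∘ (σ.Z *ᵥ μ))).IsHomogeneous (d - 1) := by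
      rw [eq_sub_of_add_eq h2.symm]
      apply (h.2.1 T e g).sub
      apply IsHomogeneous.sum
      intro f _
      simpa using (isHomogeneous_C E (c f)).mul (h.2.1 T f g)
    rw [h2, eq_zero_of_homog (gen_homog h μ T g) h3 (by omega), zero_add]
  · exfalso
    obtain ⟨κ, h1, h2⟩ := exists_sep _ _ hex
    have h3 : σ.Z *ᵥ κ = 0 := range_sep (σ.v e) κ fun u =>
      h2 _ (Submodule.mem_sup_left ⟨u, rfl⟩)
    have h4 := gen (σ := σ) κ T e
    rw [h1, h3, Finset.sum_eq_zero] at h4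
    · apply hT
      simpa [af] using h4
    · intro f hf
      rw [h2 _ (Submodule.mem_sup_right (Submodule.subset_span ⟨f, hf, rfl⟩))]
      simp

end St
end States
end Config


namespace Config

section States
open MvPolynomial Matrix

variable {K : Type} [Field K] {E : Type} [DecidableEq E]

namespace St
variable (σ : St K E)

/-- ideal of all entries -/
noncomputable def MI (S : Finset E) : Ideal (MvPolynomial E K) :=
  Ideal.span {p | ∃ f ∈ S, ∃ g ∈ S, p = σ.a S f g}

/-- ideal of row entries -/
noncomputable def NI (S : Finset E) (e : E) : Ideal (MvPolynomial E K) :=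
  Ideal.span {p | ∃ f ∈ S, p = σ.a S e f}

/-- connectedness -/
def Conn (S : Finset E) : Prop := σ.ps S ≠ 0 ∧ 2 ≤ S.card ∧ ∀ e ∈ S, ∀ f ∈ S, e ≠ f → σ.a S e f ≠ 0

variable {σ}

lemma mem_MI {S : Finset E} {f g : E} (hf : f ∈ S) (hg : g ∈ S) : σ.a S f g ∈ σ.MI S :=
  Ideal.subset_span ⟨f, hf, g, hg, rfl⟩
lemma mem_NI {S : Finset E} (e : E) {f : E} (hf : f ∈ S) : σ.a S e f ∈ σ.NI S e :=
  Ideal.subset_span ⟨f, hf, rfl⟩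
lemma mem_NI' {S : Finset E} (e : E) {f : E} (hf : f ∈ S) : σ.a S f e ∈ σ.NI S e := by
  rw [a_symm]; exact mem_NI e hf
lemma MI_le {S : Finset E} {I : Ideal (MvPolynomial E K)} (h : ∀ f ∈ S, ∀ g ∈ S, σ.a S f g ∈ I) :
    σ.MI S ≤ I := by
  rw [MI, Ideal.span_le]
  rintro _ ⟨f, hf, g, hg, rfl⟩
  exact h f hf g hg
lemma NI_le {S : Finset E} {e : E} {I : Ideal (MvPolynomial E K)} (h : ∀ g ∈ S, σ.a S e g ∈ I) :
    σ.NI S e ≤ I := by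
  rw [NI, Ideal.span_le]
  rintro _ ⟨g, hg, rfl⟩
  exact h g hg
lemma NI_le_MI {S : Finset E} {e : E} (he : e ∈ S) : σ.NI S e ≤ σ.MI S :=
  NI_le fun g hg => mem_MI he hg

lemma ps_mem_NI {S : Finset E} {d : ℕ} (h : σ.Hom d) {e : E} (he : σ.a S e e ≠ 0) :
    σ.ps S ∈ σ.NI S e := by
  obtain ⟨κ, h1, h2⟩ := kappa h he
  have := h2 S e
  rw [h1, map_one, mul_one] at this
  rw [this]
  exact Ideal.sum_mem _ fun f hf => Ideal.mul_mem_left _ _ (mem_NI' e hf)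

lemma a_con {S : Finset E} {d : ℕ} (h : σ.Hom d) {e : E} (hS : e ∈ S) (he : σ.a S e e ≠ 0) :
    ∃ κ : E → K, ∀ g, g ≠ e → σ.a S e g = σ.a S e e * C (κ g) -
      ∑ f ∈ S.erase e, X f * C (κ f) * σ.B S e f e g := by
  obtain ⟨κ, h1, h2⟩ := kappa h he
  refine ⟨κ, fun g hg => ?_⟩
  have h3 := h2 S g
  have h4 : X e * (σ.a S e e * C (κ g)) + σ.ps (S.erase e) * C (κ g) =
     X e * (σ.a S e g + ∑ f ∈ S.erase e, X f * C (κ f) * σ.B S e f e g) +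
      ∑ f ∈ S.erase e, X f * C (κ f) * σ.a (S.erase e) f g := by
    calc _ = σ.ps S * C (κ g) := by rw [σ.ps_decomp hS]; ring
      _ = _ := by
        rw [h3, ← Finset.add_sum_erase _ _ hS, h1, mul_add, Finset.mul_sum, add_assoc, ← Finset.sum_add_distrib]
        congr 1
        · simp
        · apply Finset.sum_congr rfl
          intro f hf
          rw [σ.a_decomp hS f g]
          ring
  have h5 := (decomp_unique ((σ.Fr_a S e e).mul (Fr.C e _)) ((σ.Fr_ps_erase S e).mul (Fr.C e _))
    ((σ.Fr_a S e g).add (Fr.sum _ _ fun f hf =>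
      ((Fr.X (Finset.ne_of_mem_erase hf)).mul (Fr.C e _)).mul (σ.Fr_B S e f g)))
    (Fr.sum _ _ fun f hf =>
      ((Fr.X (Finset.ne_of_mem_erase hf)).mul (Fr.C e _)).mul (σ.Fr_a_erase S e f g)) h4).1
  rw [h5]; ring

lemma cross1 {S : Finset E} (h0 : σ.ps S ≠ 0) (e f g h : E) :
    σ.B S f e f g * σ.a S e h - σ.B S f e f h * σ.a S e g = σ.a S e f * σ.B S f e h g := by
  apply mul_left_cancel₀ h0
  have h1 := σ.ps_mul_B S f e f g
  have h2 := σ.ps_mul_B S f e f h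
  have h3 := σ.ps_mul_B S f e h g
  linear_combination σ.a S e h * h1 - σ.a S e g * h2 - σ.a S e f * h3

lemma cross2 {S : Finset E} (h0 : σ.ps S ≠ 0) (e g h k l : E) :
    σ.B S e g e h * σ.a S k l - σ.B S e k e l * σ.a S g h =
      σ.a S e k * σ.B S e g l h + σ.a S e h * σ.B S e l k g := by
  apply mul_left_cancel₀ h0
  have h1 := σ.ps_mul_B S e g e h
  have h2 := σ.ps_mul_B S e k e l
  have h3 := σ.ps_mul_B S e g l h
  have h4 := σ.ps_mul_B S e l k g
  rw [σ.a_symm S g e] at h1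
  rw [σ.a_symm S k e] at h2
  rw [σ.a_symm S l g, σ.a_symm S l k] at h4
  linear_combination σ.a S k l * h1 - σ.a S g h * h2 - σ.a S e k * h3 - σ.a S e h * h4

lemma cross3 {S : Finset E} (h0 : σ.ps S ≠ 0) (e f g h : E) :
    σ.B S e f e g * σ.a S e h - σ.B S e f e h * σ.a S e g = σ.a S e e * σ.B S f e g h := by
  apply mul_left_cancel₀ h0
  have h1 := σ.ps_mul_B S e f e g
  have h2 := σ.ps_mul_B S e f e h
  have h3 := σ.ps_mul_B S f e g h
  linear_combination σ.a S e h * h1 - σ.a S e g * h2 - σ.a S e e * h3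

lemma Conn.aee {S : Finset E} {d : ℕ} (h : σ.Hom d) (hc : σ.Conn S) {e : E} (he : e ∈ S) : σ.a S e e ≠ 0 := by
  obtain ⟨f, hf, hfe⟩ := Finset.exists_mem_ne (by have := hc.2.1; omega : 1 < S.card) e
  intro h0
  exact hc.2.2 e he f hf hfe.symm (loop S σ d h e f h0)

lemma Conn.del {S : Finset E} {d : ℕ} (h : σ.Hom d) (hc : σ.Conn S) {e : E} (he : e ∈ S) :
    σ.ps (S.erase e) ≠ 0 := by
  obtain ⟨f, hf, hfe⟩ := Finset.exists_mem_ne (by have := hc.2.1; omega : 1 < S.card) e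
  intro h0
  exact hc.2.2 e he f hf hfe.symm (coloop h hf hfe h0)

lemma tutte {S : Finset E} {d : ℕ} (h : σ.Hom d) (hc : σ.Conn S) (h3 : 3 ≤ S.card) {e : E} (he : e ∈ S) :
    σ.Conn (S.erase e) ∨ (σ.con e).Conn (S.erase e) := by
  have hcard : 2 ≤ (S.erase e).card := by rw [Finset.card_erase_of_mem he]; omega
  have hp2 : (σ.con e).ps (S.erase e) ≠ 0 := by
    rw [con_ps, ← a_erase, neg_ne_zero]; exact hc.aee h he
  by_contra hcon
  push Not at hcon
  obtain ⟨hc1, hc2⟩ := hcon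
  have hd := hc.del h he
  have e1 : ∃ f ∈ S.erase e, ∃ g ∈ S.erase e, f ≠ g ∧ σ.a (S.erase e) f g = 0 := by
    by_contra hn
    push Not at hn
    exact hc1 ⟨hd, hcard, fun f hf g hg hfg => hn f hf g hg hfg⟩
  have e2 : ∃ f ∈ S.erase e, ∃ g ∈ S.erase e, f ≠ g ∧ (σ.con e).a (S.erase e) f g = 0 := by
    by_contra hn
    push Not at hn
    exact hc2 ⟨hp2, hcard, fun f hf g hg hfg => hn f hf g hg hfg⟩
  obtain ⟨f, hf, g, hg, hfg, h0⟩ := e1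
  obtain ⟨f', hf', g', hg', hfg', h0'⟩ := e2
  have key : ∀ x ∈ S.erase e, ∀ y ∈ S.erase e, x ≠ y → σ.a (S.erase e) x y = 0 →
      (σ.con e).a (S.erase e) x y ≠ 0 := by
    intro x hx y hy hxy h1 h2
    apply hc.2.2 x (Finset.mem_of_mem_erase hx) y (Finset.mem_of_mem_erase hy) hxy
    rw [σ.a_decomp he, h1, B_erase]
    rw [con_a, neg_eq_zero] at h2
    rw [h2]; simp
  have key2 : ∀ x ∈ S.erase e, x ≠ f → (σ.con e).a (S.erase e) x f ≠ 0 := by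
    intro x hx hxf
    have hfg2 := key f hf g hg hfg h0
    rcases trans_a hd hx h0 with h1 | h1
    · rw [a_symm] at h1
      exact key x hx f hf hxf h1
    · intro h2
      by_cases hxg : x = g
      · subst hxg; rw [a_symm] at h2; exact hfg2 h2
      rcases trans_a hp2 hg h2 with h4 | h4
      · exact key x hx g hg hxg h1 h4
      · rw [a_symm] at h4; exact hfg2 h4
  rcases trans_a hp2 hf h0' with h1 | h1
  · by_cases hff : f' = f
    · subst hff
      apply key2 g' hg' hfg'.symm
      rw [a_symm]; exact h0'
    · exact key2 f' hf' hff h1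
  · by_cases hff : g' = f
    · subst hff
      exact key2 f' hf' hfg' h0'
    · rw [a_symm] at h1
      exact key2 g' hg' hff h1

section Heights
variable [Finite E]

lemma NI_lower {S : Finset E} (hc : σ.Conn S) {e : E} (he : e ∈ S) (q : Ideal (MvPolynomial E K))
    [hq : q.IsPrime] (hle : σ.NI S e ≤ q) : (2 : ℕ∞) ≤ q.height := by
  obtain ⟨f0, hf0, hfe0⟩ := Finset.exists_mem_ne (by have := hc.2.1; omega : 1 < S.card) e
  obtain ⟨f, hf, hT⟩ : ∃ f ∈ S.erase e, TT f q ≠ q := by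
    by_contra hn
    push Not at hn
    exact hc.2.2 e he f0 hf0 hfe0.symm (lemC (σ.MA_a' S e f0) q hq.ne_top hn (hle (mem_NI e hf0)))
  have hfS := Finset.mem_of_mem_erase hf
  have hne := Finset.ne_of_mem_erase hf
  have hp := TT_prime f q
  have : ((1 : ℕ) : ℕ∞) ≤ (TT f q).height := by
    rw [Nat.cast_one, ENat.one_le_iff_ne_zero]
    intro h0
    rw [Ideal.height_eq_zero_iff_eq_bot] at h0
    have : σ.a S e f ∈ TT f q := mem_TT_of_Fr (σ.Fr_a_right S e f) (hle (mem_NI e hfS))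
    rw [h0] at this
    exact hc.2.2 e he f hfS hne.symm this
  exact TT_height 1 hT this

lemma MI_lower {S : Finset E} (hc : σ.Conn S) (q : Ideal (MvPolynomial E K))
    [hq : q.IsPrime] (hle : σ.MI S ≤ q) : (3 : ℕ∞) ≤ q.height := by
  obtain ⟨e, he, f, hf, hef⟩ := Finset.one_lt_card.1 (by have := hc.2.1; omega : 1 < S.card)
  obtain ⟨g, hg, hT⟩ : ∃ f ∈ S, TT f q ≠ q := by
    by_contra hn
    push Not at hn
    exact hc.2.2 e he f hf hef (lemC (σ.MA_a S e f) q hq.ne_top hn (hle (mem_MI he hf)))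
  have hp := TT_prime g q
  exact TT_height 2 hT (NI_lower hc hg _ (NI_le fun h hh => mem_TT_of_Fr (σ.Fr_a S g h) (hle (mem_MI hg hh))))

lemma mem_TT_of {e : E} {P : Ideal (MvPolynomial E K)} {f h : MvPolynomial E K} (hf : Fr e f) (hh : Fr e h)
    (h1 : f ∈ P) (h2 : X e * f + h ∈ P) : X e * f + h ∈ TT e P := by
  have h3 : h ∈ P := by
    have := P.sub_mem h2 (P.mul_mem_left (X e) h1)
    simpa using this
  exact Ideal.add_mem _ (Ideal.mul_mem_left _ _ (mem_TT_of_Fr hf h1)) (mem_TT_of_Fr hh h3)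

lemma exists_B_NI {S : Finset E} {e : E} (q : Ideal (MvPolynomial E K)) (hq : q ∈ (σ.NI S e).minimalPrimes)
    {f0 : E} (hf0 : f0 ∈ S) (hne : σ.a S e f0 ≠ 0) :
    ∃ f ∈ S, ∃ g ∈ S, σ.B S f e f g ∉ q := by
  have := hq.1.1
  by_contra hn
  push Not at hn
  apply hne
  refine lemC (σ.MA_a S e f0) q this.ne_top (fun f hf => ?_) (hq.1.2 (mem_NI e hf0))
  refine le_antisymm (TT_le f q) (hq.2 ⟨TT_prime f q, NI_le fun g hg => ?_⟩ (TT_le f q))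
  have h1 := hq.1.2 (mem_NI e hg)
  rw [σ.a_decomp hf] at h1 ⊢
  exact mem_TT_of (σ.Fr_B _ _ _ _) (σ.Fr_a_erase _ _ _ _) (hn f hf g hg) h1

lemma exists_B_MI {S : Finset E} (q : Ideal (MvPolynomial E K)) (hq : q ∈ (σ.MI S).minimalPrimes)
    {e0 f0 : E} (he0 : e0 ∈ S) (hf0 : f0 ∈ S) (hne : σ.a S e0 f0 ≠ 0) :
    ∃ e ∈ S, ∃ f ∈ S, ∃ g ∈ S, σ.B S e f e g ∉ q := by
  have := hq.1.1
  by_contra hn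
  push Not at hn
  apply hne
  refine lemC (σ.MA_a S e0 f0) q this.ne_top (fun f hf => ?_) (hq.1.2 (mem_MI he0 hf0))
  refine le_antisymm (TT_le f q) (hq.2 ⟨TT_prime f q, MI_le fun g hg h hh => ?_⟩ (TT_le f q))
  have h1 := hq.1.2 (mem_MI hg hh)
  rw [σ.a_decomp hf] at h1 ⊢
  exact mem_TT_of (σ.Fr_B _ _ _ _) (σ.Fr_a_erase _ _ _ _) (hn f hf g hg h hh) h1

lemma NI_upper {S : Finset E} (hc : σ.Conn S) {e : E} (he : e ∈ S) (q : Ideal (MvPolynomial E K))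
    (hq : q ∈ (σ.NI S e).minimalPrimes) : q.height ≤ 2 := by
  obtain ⟨f0, hf0, hfe0⟩ := Finset.exists_mem_ne (by have := hc.2.1; omega : 1 < S.card) e
  obtain ⟨f, hf, g, hg, hB⟩ := exists_B_NI q hq hf0 (hc.2.2 e he f0 hf0 hfe0.symm)
  classical
  have hmin : q ∈ (Ideal.span (({σ.a S e f, σ.a S e g} : Finset (MvPolynomial E K)) : Set (MvPolynomial E K))).minimalPrimes := by
    refine ⟨⟨hq.1.1, ?_⟩, ?_⟩
    · rw [Ideal.span_le]
      intro p hp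
      simp only [Finset.coe_insert, Finset.coe_singleton, Set.mem_insert_iff, Set.mem_singleton_iff] at hp
      rcases hp with rfl | rfl
      · exact hq.1.2 (mem_NI e hf)
      · exact hq.1.2 (mem_NI e hg)
    · rintro Q ⟨hQ, hQ2⟩ hQq
      refine hq.2 ⟨hQ, NI_le fun h hh => ?_⟩ hQq
      have h1 : σ.a S e f ∈ Q := hQ2 (Ideal.subset_span (by simp))
      have h2 : σ.a S e g ∈ Q := hQ2 (Ideal.subset_span (by simp))
      have h3 : σ.B S f e f g * σ.a S e h ∈ Q := by
        rw [eq_add_of_sub_eq (cross1 hc.1 e f g h)]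
        exact Q.add_mem (Q.mul_mem_right _ h1) (Q.mul_mem_left _ h2)
      exact (hQ.mem_or_mem h3).resolve_left fun h4 => hB (hQq h4)
  have := hq.1.1
  refine (Ideal.height_le_card_of_mem_minimalPrimes_span_finset hmin).trans ?_
  exact_mod_cast Finset.card_le_two

lemma MI_three {S : Finset E} (h0 : σ.ps S ≠ 0) {e f g : E} (Q : Ideal (MvPolynomial E K)) (hQ : Q.IsPrime)
    (h1 : σ.a S e e ∈ Q) (h2 : σ.a S e g ∈ Q) (h3 : σ.a S f g ∈ Q) (hB : σ.B S e f e g ∉ Q) : σ.MI S ≤ Q := by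
  have key : ∀ h, σ.a S e h ∈ Q := by
    intro h
    have h3 : σ.B S e f e g * σ.a S e h ∈ Q := by
      rw [eq_add_of_sub_eq (cross3 h0 e f g h)]
      exact Q.add_mem (Q.mul_mem_right _ h1) (Q.mul_mem_left _ h2)
    exact (hQ.mem_or_mem h3).resolve_left hB
  refine MI_le fun k hk l hl => ?_
  have h3 : σ.B S e f e g * σ.a S k l ∈ Q := by
    rw [eq_add_of_sub_eq (cross2 h0 e f g k l)]
    exact Q.add_mem (Q.add_mem (Q.mul_mem_right _ (key k)) (Q.mul_mem_right _ (key g))) (Q.mul_mem_left _ h3)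
  exact (hQ.mem_or_mem h3).resolve_left hB

lemma MI_upper {S : Finset E} (hc : σ.Conn S) (q : Ideal (MvPolynomial E K))
    (hq : q ∈ (σ.MI S).minimalPrimes) : q.height ≤ 3 := by
  obtain ⟨e0, he0, f0, hf0, hef0⟩ := Finset.one_lt_card.1 (by have := hc.2.1; omega : 1 < S.card)
  obtain ⟨e, he, f, hf, g, hg, hB⟩ := exists_B_MI q hq he0 hf0 (hc.2.2 e0 he0 f0 hf0 hef0)
  classical
  have hmin : q ∈ (Ideal.span (({σ.a S e e, σ.a S e g, σ.a S f g} : Finset (MvPolynomial E K)) : Set (MvPolynomial E K))).minimalPrimes := by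
    refine ⟨⟨hq.1.1, ?_⟩, ?_⟩
    · rw [Ideal.span_le]
      intro p hp
      simp only [Finset.coe_insert, Finset.coe_singleton, Set.mem_insert_iff, Set.mem_singleton_iff] at hp
      rcases hp with rfl | rfl | rfl
      · exact hq.1.2 (mem_MI he he)
      · exact hq.1.2 (mem_MI he hg)
      · exact hq.1.2 (mem_MI hf hg)
    · rintro Q ⟨hQ, hQ2⟩ hQq
      exact hq.2 ⟨hQ, MI_three hc.1 Q hQ (hQ2 (Ideal.subset_span (by simp))) (hQ2 (Ideal.subset_span (by simp)))
        (hQ2 (Ideal.subset_span (by simp))) fun h => hB (hQq h)⟩ hQq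
  have := hq.1.1
  refine (Ideal.height_le_card_of_mem_minimalPrimes_span_finset hmin).trans ?_
  exact_mod_cast Finset.card_le_three

end Heights

end St
end States
end Config


namespace Config

section States
open MvPolynomial Matrix

variable {K : Type} [Field K] {E : Type} [DecidableEq E]

lemma radical_sup_X {e : E} (N : Ideal (MvPolynomial E K)) (hN : N.IsRadical)
    (hNf : ∃ G : Set (MvPolynomial E K), N = Ideal.span G ∧ ∀ p ∈ G, Fr e p) :
    (N ⊔ Ideal.span {X e}).IsRadical := by
  have h1 : Ideal.span (Set.range fun _ : Unit => (1 : MvPolynomial E K)) = ⊤ :=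
    Ideal.eq_top_of_isUnit_mem _ (Ideal.subset_span ⟨(), rfl⟩) isUnit_one
  have h := lemBR (ι := Unit) e N ⊤ (fun _ => 1) (fun _ => 0) hN (fun _ _ => trivial) (by rw [h1, sup_top_eq])
    (by simp) (fun q hq h => hq.1.1.ne_top (top_le_iff.1 h)) hNf (fun _ => Fr.one e) (fun _ => Fr.zero e)
  simpa using h

namespace St
variable {σ : St K E}

lemma MI_gens_homog {d : ℕ} (h : σ.Hom d) (S : Finset E) :
    ∃ G : Set (MvPolynomial E K), σ.MI S = Ideal.span G ∧ ∀ p ∈ G, ∃ n, p.IsHomogeneous n := by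
  refine ⟨_, rfl, ?_⟩
  rintro _ ⟨f, _, g, _, rfl⟩
  exact ⟨_, h.2.1 S f g⟩

lemma NI_gens_homog {d : ℕ} (h : σ.Hom d) (S : Finset E) (e : E) :
    ∃ G : Set (MvPolynomial E K), σ.NI S e = Ideal.span G ∧ ∀ p ∈ G, ∃ n, p.IsHomogeneous n := by
  refine ⟨_, rfl, ?_⟩
  rintro _ ⟨f, _, rfl⟩
  exact ⟨_, h.2.1 S e f⟩

lemma MI_gens_Fr {S : Finset E} {e : E} (he : e ∉ S) :
    ∃ G : Set (MvPolynomial E K), σ.MI S = Ideal.span G ∧ ∀ p ∈ G, Fr e p := by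
  refine ⟨_, rfl, ?_⟩
  rintro _ ⟨f, _, g, _, rfl⟩
  exact (σ.MA_a S f g).Fr he

lemma NI_gens_Fr {S : Finset E} {e f : E} (hf : f ∉ S ∨ f = e) :
    ∃ G : Set (MvPolynomial E K), σ.NI S e = Ideal.span G ∧ ∀ p ∈ G, Fr f p := by
  refine ⟨_, rfl, ?_⟩
  rintro _ ⟨g, _, rfl⟩
  rcases hf with hf | rfl
  · exact (σ.MA_a S e g).Fr hf
  · exact σ.Fr_a S f g

lemma le_TT_of_gens {e : E} {P I : Ideal (MvPolynomial E K)}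
    (hG : ∃ G : Set (MvPolynomial E K), I = Ideal.span G ∧ ∀ p ∈ G, Fr e p) (h : I ≤ P) : I ≤ TT e P := by
  obtain ⟨G, rfl, hG⟩ := hG
  exact span_le_TT hG h

lemma a_erase_mem {S : Finset E} {e : E} (he : e ∈ S) {I : Ideal (MvPolynomial E K)} (hX : X e ∈ I) (f g : E) :
    σ.a (S.erase e) f g ∈ I ↔ σ.a S f g ∈ I := by
  rw [σ.a_decomp he f g]
  exact (I.add_mem_iff_right (I.mul_mem_right _ hX)).symm

lemma mem_spanning {T : Finset E} {d : ℕ} (h : σ.Hom d) (hT : σ.ps T ≠ 0) (I : Ideal (MvPolynomial E K)) (g : E)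
    (hI : ∀ f ∈ T, σ.a T f g ∈ I) (e : E) : σ.a T e g ∈ I := by
  obtain ⟨c, hc⟩ := spanning h hT e
  rw [hc]
  exact I.sum_mem fun f hf => I.mul_mem_left _ (hI f hf)

lemma mem_MI_all {T : Finset E} {d : ℕ} (h : σ.Hom d) (hT : σ.ps T ≠ 0) (f g : E) : σ.a T f g ∈ σ.MI T := by
  apply mem_spanning h hT
  intro k hk
  rw [a_symm]
  apply mem_spanning h hT
  intro l hl
  exact mem_MI hl hk

lemma NI_sup {S : Finset E} {d : ℕ} (h : σ.Hom d) {e f : E} (hf : f ∈ S) (hT : σ.ps (S.erase f) ≠ 0) :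
    σ.NI S e ⊔ Ideal.span {X f} = σ.NI (S.erase f) e ⊔ Ideal.span {X f} := by
  have hX : ∀ I : Ideal (MvPolynomial E K), X f ∈ I ⊔ Ideal.span {X f} := fun I =>
    Ideal.mem_sup_right (Ideal.mem_span_singleton_self _)
  apply le_antisymm
  · refine sup_le (NI_le fun g hg => ?_) le_sup_right
    rw [← a_erase_mem hf (hX _), a_symm]
    apply mem_spanning h hT
    intro k hk
    exact Ideal.mem_sup_left (mem_NI' e hk)
  · refine sup_le (NI_le fun g hg => ?_) le_sup_right
    rw [a_erase_mem hf (hX _)]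
    exact Ideal.mem_sup_left (mem_NI e (Finset.mem_of_mem_erase hg))

lemma MI_sup {S : Finset E} {d : ℕ} (h : σ.Hom d) {f : E} (hf : f ∈ S) (hT : σ.ps (S.erase f) ≠ 0) :
    σ.MI S ⊔ Ideal.span {X f} = σ.MI (S.erase f) ⊔ Ideal.span {X f} := by
  have hX : ∀ I : Ideal (MvPolynomial E K), X f ∈ I ⊔ Ideal.span {X f} := fun I =>
    Ideal.mem_sup_right (Ideal.mem_span_singleton_self _)
  apply le_antisymm
  · refine sup_le (MI_le fun k hk g hg => ?_) le_sup_right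
    rw [← a_erase_mem hf (hX _)]
    exact Ideal.mem_sup_left (mem_MI_all h hT k g)
  · refine sup_le (MI_le fun k hk g hg => ?_) le_sup_right
    rw [a_erase_mem hf (hX _)]
    exact Ideal.mem_sup_left (mem_MI (Finset.mem_of_mem_erase hk) (Finset.mem_of_mem_erase hg))

lemma unit_of_card_two {S : Finset E} (hc : σ.Conn S) (h2 : S.card = 2) {e f : E} (he : e ∈ S) (hf : f ∈ S)
    (hef : e ≠ f) : IsUnit (σ.a S e f) := by
  have h1 := σ.MA_a'' S e f
  have : (S.erase e).erase f = ∅ := by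
    rw [← Finset.card_eq_zero, Finset.card_erase_of_mem (by simp [hf, hef.symm]), Finset.card_erase_of_mem he, h2]
  rw [this] at h1
  obtain ⟨c, hc'⟩ := h1.eq_C
  have h3 := hc.2.2 e he f hf hef
  rw [hc'] at h3 ⊢
  have hc0 : c ≠ 0 := by rintro rfl; simp at h3
  exact (isUnit_iff_ne_zero.2 hc0).map C

variable [Finite E]

lemma NI_rad (n : ℕ) : ∀ (σ : St K E) (d : ℕ) (S : Finset E) (e : E), S.card = n → σ.Hom d → σ.Conn S → e ∈ S →
    (σ.NI S e).IsRadical := by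
  induction n with
  | zero =>
    intro σ d S e hn h hc he
    have := hc.2.1
    omega
  | succ n ih =>
  intro σ d S e hn h hc he
  obtain ⟨f, hf, hfe⟩ := Finset.exists_mem_ne (by have := hc.2.1; omega : 1 < S.card) e
  by_cases h2 : S.card = 2
  · rw [Ideal.eq_top_of_isUnit_mem _ (mem_NI e hf) (unit_of_card_two hc h2 he hf hfe.symm)]
    exact fun _ _ => trivial
  have h3 : 3 ≤ S.card := by have := hc.2.1; omega
  have hn' : (S.erase f).card = n := by rw [Finset.card_erase_of_mem hf]; omega
  have he' : e ∈ S.erase f := by simp [he, hfe.symm]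
  rcases tutte h hc h3 hf with hc' | hc'
  · apply graded_radical _ f (NI_gens_homog h S e)
    · rw [NI_sup h hf hc'.1]
      exact radical_sup_X _ (ih σ d _ e hn' h hc' he') (NI_gens_Fr (Or.inl (Finset.notMem_erase _ _)))
    · intro P hP hX
      have hPp := hP.1.1
      have h1 := NI_upper hc he P hP
      have hle : σ.NI (S.erase f) e ≤ P := NI_le fun g hg => by
        rw [a_erase_mem hf hX]
        exact hP.1.2 (mem_NI e (Finset.mem_of_mem_erase hg))
      have := TT_prime f P
      have h4 := NI_lower hc' he' (TT f P) (le_TT_of_gens (NI_gens_Fr (Or.inl (Finset.notMem_erase _ _))) hle)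
      have h5 := TT_height (P := P) 2 (fun heq => X_notMem_TT f P hPp.ne_top (by rw [heq]; exact hX)) h4
      exact absurd (h5.trans h1) (by decide)
  · have hC := h.con f
    have hm := ih _ _ _ e hn' hC hc' he'
    have hBm : ∀ g ∈ S.erase f, σ.B S f e f g ∈ (σ.con f).NI (S.erase f) e := by
      intro g hg
      have := mem_NI (σ := σ.con f) e hg
      rw [con_a, ← B_erase] at this
      simpa using this
    have haff : σ.a S f f ∈ (σ.con f).NI (S.erase f) e := by
      have := ps_mem_NI hC (hc'.aee hC he')
      rw [con_ps, ← a_erase] at this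
      simpa using this
    have haef : σ.a S e f ∈ (σ.con f).NI (S.erase f) e := by
      obtain ⟨κ, hκ⟩ := a_con h hf (hc.aee h hf)
      rw [a_symm, hκ e hfe.symm]
      refine Ideal.sub_mem _ (Ideal.mul_mem_right _ _ haff) (Ideal.sum_mem _ fun g hg => Ideal.mul_mem_left _ _ ?_)
      rw [B_transpose]
      exact hBm g hg
    have key := lemBR (ι := {g // g ∈ S.erase f}) f (Ideal.span {σ.a S e f}) ((σ.con f).NI (S.erase f) e)
      (fun g => σ.B S f e f g) (fun g => σ.a (S.erase f) e g) (σ.MA_a S e f).span_radical hm ?_ ?_ ?_ ?_ ?_ ?_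
    · convert key using 1
      apply le_antisymm
      · refine NI_le fun g hg => ?_
        by_cases hgf : g = f
        · rw [hgf]
          exact Ideal.mem_sup_left (Ideal.mem_span_singleton_self _)
        · refine Ideal.mem_sup_right (Ideal.subset_span ⟨⟨g, by simp [hg, hgf]⟩, ?_⟩)
          exact (σ.a_decomp hf e g).symm
      · refine sup_le ?_ ?_
        · rw [Ideal.span_singleton_le_iff_mem]
          exact mem_NI e hf
        · rw [Ideal.span_le]
          rintro _ ⟨⟨g, hg⟩, rfl⟩
          simp only
          rw [← σ.a_decomp hf e g]
          exact mem_NI e (Finset.mem_of_mem_erase hg)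
    · apply le_antisymm
      · refine NI_le fun g hg => Ideal.mem_sup_right ?_
        rw [con_a, ← B_erase]
        exact Ideal.neg_mem_iff _ |>.2 (Ideal.subset_span ⟨⟨g, hg⟩, rfl⟩)
      · refine sup_le ?_ ?_
        · rwa [Ideal.span_singleton_le_iff_mem]
        · rw [Ideal.span_le]
          rintro _ ⟨⟨g, hg⟩, rfl⟩
          exact hBm g hg
    · rintro ⟨g, hg⟩ ⟨k, hk⟩
      rw [Ideal.mem_span_singleton]
      refine ⟨σ.B S f e k g, ?_⟩
      rw [← cross1 hc.1, σ.a_decomp hf e g, σ.a_decomp hf e k]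
      ring
    · intro q hq hle
      have := hq.1.1
      have h1 := NI_lower hc' he' q hle
      have h4 : q.height ≤ 1 := by
        classical
        have hq' : q ∈ (Ideal.span (({σ.a S e f} : Finset (MvPolynomial E K)) : Set (MvPolynomial E K))).minimalPrimes := by
          simpa using hq
        simpa using Ideal.height_le_card_of_mem_minimalPrimes_span_finset hq'
      exact absurd (h1.trans h4) (by decide)
    · refine ⟨_, rfl, ?_⟩
      rintro _ rfl
      exact σ.Fr_a_right S e f
    · rintro ⟨g, hg⟩
      exact σ.Fr_B S f e g
    · rintro ⟨g, hg⟩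
      exact σ.Fr_a_erase S f e g

/-- radicality in the connected case, given the induction hypothesis -/
lemma MI_rad_conn (n : ℕ) (ih : ∀ (σ : St K E) (d : ℕ) (S : Finset E), S.card = n → σ.Hom d → σ.ps S ≠ 0 →
    (σ.MI S).IsRadical) (σ : St K E) (d : ℕ) (S : Finset E) (hn : S.card = n + 1) (h : σ.Hom d) (hc : σ.Conn S) :
    (σ.MI S).IsRadical := by
  obtain ⟨e, he, f, hf, hef⟩ := Finset.one_lt_card.1 (by have := hc.2.1; omega : 1 < S.card)
  by_cases h2 : S.card = 2
  · rw [Ideal.eq_top_of_isUnit_mem _ (mem_MI he hf) (unit_of_card_two hc h2 he hf hef)]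
    exact fun _ _ => trivial
  have h3 : 3 ≤ S.card := by have := hc.2.1; omega
  have hn' : (S.erase e).card = n := by rw [Finset.card_erase_of_mem he]; omega
  rcases tutte h hc h3 he with hc' | hc'
  · apply graded_radical _ e (MI_gens_homog h S)
    · rw [MI_sup h he hc'.1]
      exact radical_sup_X _ (ih σ d _ hn' h hc'.1) (MI_gens_Fr (Finset.notMem_erase _ _))
    · intro P hP hX
      have hPp := hP.1.1
      have h1 := MI_upper hc P hP
      have hle : σ.MI (S.erase e) ≤ P := MI_le fun k hk g hg => by
        rw [a_erase_mem he hX]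
        exact hP.1.2 (mem_MI (Finset.mem_of_mem_erase hk) (Finset.mem_of_mem_erase hg))
      have := TT_prime e P
      have h4 := MI_lower hc' (TT e P) (le_TT_of_gens (MI_gens_Fr (Finset.notMem_erase _ _)) hle)
      have h5 := TT_height (P := P) 3 (fun heq => X_notMem_TT e P hPp.ne_top (by rw [heq]; exact hX)) h4
      exact absurd (h5.trans h1) (by decide)
  · have hC := h.con e
    have hf' : f ∈ S.erase e := by simp [hf, hef.symm]
    have hm := ih _ _ _ hn' hC hc'.1
    have hBm : ∀ k ∈ S.erase e, ∀ g ∈ S.erase e, σ.B S e k e g ∈ (σ.con e).MI (S.erase e) := by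
      intro k hk g hg
      have := mem_MI (σ := σ.con e) hk hg
      rw [con_a, ← B_erase] at this
      simpa using this
    have haee : σ.a S e e ∈ (σ.con e).MI (S.erase e) := by
      have := NI_le_MI hf' (ps_mem_NI hC (hc'.aee hC hf'))
      rw [con_ps, ← a_erase] at this
      simpa using this
    have haeg : ∀ g ∈ S, σ.a S e g ∈ (σ.con e).MI (S.erase e) := by
      intro g hg
      by_cases hge : g = e
      · rw [hge]; exact haee
      obtain ⟨κ, hκ⟩ := a_con h he (hc.aee h he)
      rw [hκ g hge]
      refine Ideal.sub_mem _ (Ideal.mul_mem_right _ _ haee) (Ideal.sum_mem _ fun k hk => Ideal.mul_mem_left _ _ ?_)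
      exact hBm k hk g (by simp [hg, hge])
    have key := lemBR (ι := {g // g ∈ S.erase e} × {g // g ∈ S.erase e}) e (σ.NI S e) ((σ.con e).MI (S.erase e))
      (fun g => σ.B S e g.1 e g.2) (fun g => σ.a (S.erase e) g.1 g.2) (NI_rad _ σ d S e rfl h hc he) hm ?_ ?_ ?_ ?_ ?_ ?_
    · convert key using 1
      apply le_antisymm
      · refine MI_le fun k hk g hg => ?_
        by_cases hke : k = e
        · rw [hke]
          exact Ideal.mem_sup_left (mem_NI e hg)
        by_cases hge : g = e
        · rw [hge]
          exact Ideal.mem_sup_left (mem_NI' e hk)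
        · refine Ideal.mem_sup_right (Ideal.subset_span ⟨(⟨k, by simp [hk, hke]⟩, ⟨g, by simp [hg, hge]⟩), ?_⟩)
          exact (σ.a_decomp he k g).symm
      · refine sup_le (NI_le_MI he) ?_
        rw [Ideal.span_le]
        rintro _ ⟨⟨⟨k, hk⟩, ⟨g, hg⟩⟩, rfl⟩
        simp only
        rw [← σ.a_decomp he k g]
        exact mem_MI (Finset.mem_of_mem_erase hk) (Finset.mem_of_mem_erase hg)
    · apply le_antisymm
      · refine MI_le fun k hk g hg => Ideal.mem_sup_right ?_
        rw [con_a, ← B_erase]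
        exact Ideal.neg_mem_iff _ |>.2 (Ideal.subset_span ⟨(⟨k, hk⟩, ⟨g, hg⟩), rfl⟩)
      · refine sup_le (NI_le haeg) ?_
        rw [Ideal.span_le]
        rintro _ ⟨⟨⟨k, hk⟩, ⟨g, hg⟩⟩, rfl⟩
        exact hBm k hk g hg
    · rintro ⟨⟨g, hg⟩, ⟨k, hk⟩⟩ ⟨⟨l, hl⟩, ⟨m, hm⟩⟩
      have := cross2 hc.1 e g k l m
      have h5 : σ.B S e g e k * σ.a (S.erase e) l m - σ.B S e l e m * σ.a (S.erase e) g k =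
          σ.a S e l * σ.B S e g m k + σ.a S e k * σ.B S e m l g := by
        rw [← this, σ.a_decomp he l m, σ.a_decomp he g k]
        ring
      simp only
      rw [h5]
      exact Ideal.add_mem _ (Ideal.mul_mem_right _ _ (mem_NI e (Finset.mem_of_mem_erase hl)))
        (Ideal.mul_mem_right _ _ (mem_NI e (Finset.mem_of_mem_erase hk)))
    · intro q hq hle
      have := hq.1.1
      exact absurd ((MI_lower hc' q hle).trans (NI_upper hc he q hq)) (by decide)
    · exact NI_gens_Fr (Or.inr rfl)
    · rintro ⟨⟨k, hk⟩, ⟨g, hg⟩⟩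
      exact σ.Fr_B S e k g
    · rintro ⟨⟨k, hk⟩, ⟨g, hg⟩⟩
      exact σ.Fr_a_erase S e k g

end St
end States
end Config


namespace Config

section LogDeriv
open MvPolynomial

variable {K : Type} [Field K] {E : Type} [DecidableEq E]

lemma pderiv_Fr {e : E} {p : MvPolynomial E K} (hp : Fr e p) : pderiv e p = 0 := by
  apply pderiv_eq_zero_of_notMem_vars
  intro h
  have := mem_supported.1 hp (by exact_mod_cast h)
  simp at this

lemma MA.pderiv {S : Finset E} {p : MvPolynomial E K} (hp : MA S p) (g : E) : MA S (pderiv g p) := by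
  induction hp with
  | const c => rw [pderiv_C]; exact MA.zero _
  | step S e he f h hf hh ihf ihh =>
    rw [map_add, Derivation.leibniz]
    by_cases hg : g = e
    · subst hg
      rw [pderiv_Fr (hf.Fr he), pderiv_Fr (hh.Fr he), pderiv_X_self]
      simpa using hf.insert g
    · rw [pderiv_X_of_ne (Ne.symm hg), smul_zero, add_zero, smul_eq_mul]
      exact MA.step _ _ he _ _ ihf ihh

lemma quad_unique {e : E} {a b c a' b' c' : MvPolynomial E K} (ha : Fr e a) (hb : Fr e b) (hc : Fr e c)
    (ha' : Fr e a') (hb' : Fr e b') (hc' : Fr e c')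
    (h : X e ^ 2 * a + X e * b + c = X e ^ 2 * a' + X e * b' + c') : a = a' ∧ c = c' := by
  have h1 := congrArg (sb e Polynomial.X) h
  simp only [map_add, map_mul, map_pow, sb_X, sb_Fr _ ha, sb_Fr _ hb, sb_Fr _ hc, sb_Fr _ ha', sb_Fr _ hb',
    sb_Fr _ hc'] at h1
  constructor
  · have := congrArg (fun p => Polynomial.coeff p 2) h1
    simpa [Polynomial.coeff_C, Polynomial.coeff_mul_C, Polynomial.coeff_X, Polynomial.coeff_X_pow] using this
  · have := congrArg (fun p => Polynomial.coeff p 0) h1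
    simpa [Polynomial.coeff_C, Polynomial.coeff_mul_C, Polynomial.coeff_X, Polynomial.coeff_X_pow] using this

lemma log_deriv {S₂ : Finset E} (S₁ : Finset E) : Disjoint S₁ S₂ → ∀ p q : MvPolynomial E K, MA S₁ p → p ≠ 0 → MA (S₁ ∪ S₂) q →
    (∀ f ∈ S₁, p * pderiv f q = q * pderiv f p) → ∃ h, MA S₂ h ∧ q = p * h := by
  induction S₁ using Finset.induction_on with
  | empty =>
    intro _ p q hp hp0 hq _
    obtain ⟨c, rfl⟩ := hp.eq_C
    rw [Finset.empty_union] at hq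
    have hc : c ≠ 0 := by rintro rfl; simp at hp0
    refine ⟨C c⁻¹ * q, hq.smul _, ?_⟩
    rw [← mul_assoc, ← map_mul, mul_inv_cancel₀ hc, map_one, one_mul]
  | insert e S he ih =>
    intro hd p q hp hp0 hq hder
    rw [Finset.disjoint_insert_left] at hd
    obtain ⟨p1, p0, hp1, hp0', rfl⟩ := hp.decomp (Finset.mem_insert_self e S)
    obtain ⟨q1, q0, hq1, hq0, rfl⟩ := hq.decomp (by simp : e ∈ insert e S ∪ S₂)
    rw [Finset.erase_insert he] at hp1 hp0'
    have hS : (insert e S ∪ S₂).erase e = S ∪ S₂ := by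
      rw [Finset.insert_union, Finset.erase_insert (by simp [he, hd.1])]
    rw [hS] at hq1 hq0
    have heS : e ∉ S ∪ S₂ := by simp [he, hd.1]
    have hE := hder e (Finset.mem_insert_self e S)
    simp only [map_add, Derivation.leibniz, pderiv_X_self, pderiv_Fr (hp1.Fr he), pderiv_Fr (hp0'.Fr he),
      pderiv_Fr (hq1.Fr heS), pderiv_Fr (hq0.Fr heS), smul_eq_mul, mul_zero, mul_one, zero_add, add_zero] at hE
    have hE' : p0 * q1 = q0 * p1 := by linear_combination hE
    have hder' : ∀ f ∈ S, p1 * pderiv f q1 = q1 * pderiv f p1 ∧ p0 * pderiv f q0 = q0 * pderiv f p0 := by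
      intro f hf
      have hfe : e ≠ f := fun h => he (h ▸ hf)
      have h1 := hder f (Finset.mem_insert_of_mem hf)
      simp only [map_add, Derivation.leibniz, pderiv_X_of_ne hfe, smul_eq_mul, mul_zero, zero_add, add_zero] at h1
      refine quad_unique (e := e) (b := p1 * pderiv f q0 + p0 * pderiv f q1) (b' := q1 * pderiv f p0 + q0 * pderiv f p1)
        ((hp1.Fr he).mul ((hq1.pderiv f).Fr heS)) ?_ ((hp0'.Fr he).mul ((hq0.pderiv f).Fr heS))
        ((hq1.Fr heS).mul ((hp1.pderiv f).Fr he)) ?_ ((hq0.Fr heS).mul ((hp0'.pderiv f).Fr he)) ?_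
      · exact ((hp1.Fr he).mul ((hq0.pderiv f).Fr heS)).add ((hp0'.Fr he).mul ((hq1.pderiv f).Fr heS))
      · exact ((hq1.Fr heS).mul ((hp0'.pderiv f).Fr he)).add ((hq0.Fr heS).mul ((hp1.pderiv f).Fr he))
      · linear_combination h1
    by_cases h1 : p1 = 0
    · subst h1
      have h0 : p0 ≠ 0 := by simpa using hp0
      obtain ⟨h, hh, rfl⟩ := ih hd.2 p0 q0 hp0' h0 hq0 fun f hf => (hder' f hf).2
      have : q1 = 0 := by
        rw [mul_zero] at hE'
        exact (mul_eq_zero.1 hE').resolve_left h0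
      exact ⟨h, hh, by rw [this]; ring⟩
    · obtain ⟨h, hh, rfl⟩ := ih hd.2 p1 q1 hp1 h1 hq1 fun f hf => (hder' f hf).1
      have : q0 = p0 * h := by
        apply mul_right_cancel₀ h1
        linear_combination -hE'
      exact ⟨h, hh, by rw [this]; ring⟩

end LogDeriv

section States
open MvPolynomial Matrix

variable {K : Type} [Field K] {E : Type} [DecidableEq E]

namespace St

lemma pderiv_ps (σ : St K E) {S : Finset E} {f : E} (hf : f ∈ S) : pderiv f (σ.ps S) = σ.a S f f := by
  rw [σ.ps_decomp hf, map_add, Derivation.leibniz, pderiv_Fr (σ.Fr_a S f f), pderiv_Fr (σ.Fr_ps_erase S f),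
    pderiv_X_self]
  simp

lemma a_zero_decomp {σ : St K E} {S : Finset E} {e : E} (he : e ∈ S) {f g : E} (h : σ.a S f g = 0) :
    σ.B S e f e g = 0 ∧ σ.a (S.erase e) f g = 0 := by
  rw [σ.a_decomp he] at h
  exact decomp_unique (σ.Fr_B _ _ _ _) (σ.Fr_a_erase _ _ _ _) (Fr.zero e) (Fr.zero e)
    (by rw [h]; simp)

lemma separate {S₁ : Finset E} (S₂ : Finset E) : Disjoint S₁ S₂ → ∀ (σ : St K E) (d : ℕ), σ.Hom d →
    σ.ps (S₁ ∪ S₂) ≠ 0 → (∀ f ∈ S₁, ∀ g ∈ S₂, σ.a (S₁ ∪ S₂) f g = 0) →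
    ∃ (σ' : St K E) (d' : ℕ), σ'.Hom d' ∧ σ'.ps S₁ ≠ 0 ∧ ∀ f ∈ S₁, ∀ g ∈ S₁,
      σ.a (S₁ ∪ S₂) f g * σ'.ps S₁ = σ.ps (S₁ ∪ S₂) * σ'.a S₁ f g := by
  induction S₂ using Finset.induction_on with
  | empty =>
    intro _ σ d h h0 _
    rw [Finset.union_empty] at h0 ⊢
    exact ⟨σ, d, h, h0, fun f _ g _ => mul_comm _ _⟩
  | insert k S₂ hk ih =>
    intro hd σ d h h0 hcr
    rw [Finset.disjoint_insert_right] at hd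
    have hS : (S₁ ∪ insert k S₂).erase k = S₁ ∪ S₂ := by
      rw [Finset.union_insert, Finset.erase_insert (by simp [hk, hd.1])]
    have hkS : k ∈ S₁ ∪ insert k S₂ := by simp
    have hB : ∀ f ∈ S₁, ∀ g ∈ S₁, σ.ps (S₁ ∪ insert k S₂) * σ.B (S₁ ∪ insert k S₂) k f k g =
        σ.a (S₁ ∪ insert k S₂) k k * σ.a (S₁ ∪ insert k S₂) f g := by
      intro f hf g hg
      rw [ps_mul_B, hcr f hf k (by simp)]
      ring
    have hcr' : ∀ f ∈ S₁, ∀ g ∈ S₂, σ.B (S₁ ∪ insert k S₂) k f k g = 0 ∧ σ.a (S₁ ∪ S₂) f g = 0 := by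
      intro f hf g hg
      have := a_zero_decomp hkS (hcr f hf g (by simp [hg]))
      rwa [hS] at this
    have hps := σ.ps_decomp hkS
    by_cases hp : σ.ps (S₁ ∪ S₂) = 0
    · rw [hS, hp, add_zero] at hps
      have hkk : σ.a (S₁ ∪ insert k S₂) k k ≠ 0 := fun h1 => h0 (by rw [hps, h1, mul_zero])
      have hcps : (σ.con k).ps (S₁ ∪ S₂) = - σ.a (S₁ ∪ insert k S₂) k k := by
        rw [con_ps, σ.a_erase (S₁ ∪ insert k S₂), hS]
      have hca : ∀ f g, (σ.con k).a (S₁ ∪ S₂) f g = - σ.B (S₁ ∪ insert k S₂) k f k g := by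
        intro f g
        rw [con_a, σ.B_erase (S := S₁ ∪ insert k S₂), hS]
      have hc0 : (σ.con k).ps (S₁ ∪ S₂) ≠ 0 := by rwa [hcps, neg_ne_zero]
      obtain ⟨σ', d', h1, h2, h3⟩ := ih hd.2 (σ.con k) _ (h.con k) hc0
        (fun f hf g hg => by rw [hca, (hcr' f hf g hg).1, neg_zero])
      refine ⟨σ', d', h1, h2, fun f hf g hg => ?_⟩
      apply mul_left_cancel₀ hc0
      have h4 := h3 f hf g hg
      have h5 := hB f hf g hg
      rw [hca, hcps] at h4
      rw [hcps]
      linear_combination (σ.ps (S₁ ∪ insert k S₂)) * h4 + σ'.ps S₁ * h5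
    · obtain ⟨σ', d', h1, h2, h3⟩ := ih hd.2 σ d h hp (fun f hf g hg => (hcr' f hf g hg).2)
      refine ⟨σ', d', h1, h2, fun f hf g hg => ?_⟩
      apply mul_left_cancel₀ hp
      have h4 := h3 f hf g hg
      have h5 := hB f hf g hg
      have h6 := σ.a_decomp hkS f g
      rw [hS] at h6 hps
      rw [h6] at h5 ⊢
      rw [hps] at h5 ⊢
      linear_combination X k * σ'.ps S₁ * h5 + (X k * σ.a (S₁ ∪ insert k S₂) k k + σ.ps (S₁ ∪ S₂)) * h4

lemma const_of {σ : St K E} (S : Finset E) : (∀ f ∈ S, σ.a S f f = 0) → ∃ c, σ.ps S = C c := by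
  induction S using Finset.induction_on with
  | empty => intro _; exact (σ.MA_ps ∅).eq_C
  | insert k S hk ih =>
    intro h
    rw [ps_insert _ hk]
    have h1 := h k (by simp)
    rw [a_erase, Finset.erase_insert hk] at h1
    rw [h1, mul_zero, zero_add]
    apply ih
    intro f hf
    have := (a_zero_decomp (by simp : k ∈ insert k S) (h f (by simp [hf]))).2
    rwa [Finset.erase_insert hk] at this

lemma nzd {σ : St K E} {S T : Finset E} (hd : Disjoint S T) (hr : (σ.MI S).IsRadical) {p : MvPolynomial E K}
    (hp : MA T p) (hp0 : p ≠ 0) {x : MvPolynomial E K} (hx : x * p ∈ σ.MI S) : x ∈ σ.MI S := by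
  rw [← hr.radical, ← Ideal.sInf_minimalPrimes, Submodule.mem_sInf]
  intro P hP
  have hPp := hP.1.1
  refine (hPp.mem_or_mem (hP.1.2 hx)).resolve_right fun hm => hp0 (lemC hp P hPp.ne_top (fun e he => ?_) hm)
  obtain ⟨G, hG, hG2⟩ := MI_gens_Fr (σ := σ) (S := S) (e := e) (Finset.disjoint_right.1 hd he)
  rw [hG] at hP
  exact TT_eq_of_minimal hG2 hP

lemma union_rad {σ σ₁ σ₂ : St K E} {S₁ S₂ : Finset E} {d₁ d₂ : ℕ} (h₁ : σ₁.Hom d₁) (h₂ : σ₂.Hom d₂)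
    (hd : Disjoint S₁ S₂) (hp1 : σ₁.ps S₁ ≠ 0) (hp2 : σ₂.ps S₂ ≠ 0) (c : K) (hc : c ≠ 0)
    (ha1 : ∀ f ∈ S₁, ∀ g ∈ S₁, σ.a (S₁ ∪ S₂) f g = C c * σ₂.ps S₂ * σ₁.a S₁ f g)
    (ha2 : ∀ f ∈ S₂, ∀ g ∈ S₂, σ.a (S₁ ∪ S₂) f g = C c * σ₁.ps S₁ * σ₂.a S₂ f g)
    (hcr : ∀ f ∈ S₁, ∀ g ∈ S₂, σ.a (S₁ ∪ S₂) f g = 0)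
    (r1 : (σ₁.MI S₁).IsRadical) (r2 : (σ₂.MI S₂).IsRadical) : (σ.MI (S₁ ∪ S₂)).IsRadical := by
  have hcc : (C c⁻¹ * C c : MvPolynomial E K) = 1 := by rw [← map_mul, inv_mul_cancel₀ hc, map_one]
  have in1 : ∀ x ∈ σ₁.MI S₁, σ₂.ps S₂ * x ∈ σ.MI (S₁ ∪ S₂) := by
    intro x hx
    have : σ₁.MI S₁ ≤ Submodule.comap (LinearMap.mulLeft (MvPolynomial E K) (σ₂.ps S₂)) (σ.MI (S₁ ∪ S₂)) := by
      rw [MI, Ideal.span, Submodule.span_le]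
      rintro _ ⟨f, hf, g, hg, rfl⟩
      simp only [SetLike.mem_coe, Submodule.mem_comap, LinearMap.mulLeft_apply]
      have : σ₂.ps S₂ * σ₁.a S₁ f g = C c⁻¹ * σ.a (S₁ ∪ S₂) f g := by
        rw [ha1 f hf g hg]
        linear_combination (- σ₂.ps S₂ * σ₁.a S₁ f g) * hcc
      rw [this]
      exact Ideal.mul_mem_left _ _ (mem_MI (by simp [hf]) (by simp [hg]))
    exact this hx
  have in2 : ∀ x ∈ σ₂.MI S₂, σ₁.ps S₁ * x ∈ σ.MI (S₁ ∪ S₂) := by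
    intro x hx
    have : σ₂.MI S₂ ≤ Submodule.comap (LinearMap.mulLeft (MvPolynomial E K) (σ₁.ps S₁)) (σ.MI (S₁ ∪ S₂)) := by
      rw [MI, Ideal.span, Submodule.span_le]
      rintro _ ⟨f, hf, g, hg, rfl⟩
      simp only [SetLike.mem_coe, Submodule.mem_comap, LinearMap.mulLeft_apply]
      have : σ₁.ps S₁ * σ₂.a S₂ f g = C c⁻¹ * σ.a (S₁ ∪ S₂) f g := by
        rw [ha2 f hf g hg]
        linear_combination (- σ₁.ps S₁ * σ₂.a S₂ f g) * hcc
      rw [this]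
      exact Ideal.mul_mem_left _ _ (mem_MI (by simp [hf]) (by simp [hg]))
    exact this hx
  have out : ∀ I : Ideal (MvPolynomial E K), (∀ x ∈ σ₁.MI S₁, σ₂.ps S₂ * x ∈ I) →
      (∀ x ∈ σ₂.MI S₂, σ₁.ps S₁ * x ∈ I) → σ.MI (S₁ ∪ S₂) ≤ I := by
    intro I h1 h2
    refine MI_le fun f hf g hg => ?_
    rcases Finset.mem_union.1 hf with hf | hf <;> rcases Finset.mem_union.1 hg with hg | hg
    · rw [ha1 f hf g hg, mul_assoc]
      exact I.mul_mem_left _ (h1 _ (mem_MI hf hg))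
    · rw [hcr f hf g hg]; exact I.zero_mem
    · rw [a_symm, hcr g hg f hf]; exact I.zero_mem
    · rw [ha2 f hf g hg, mul_assoc]
      exact I.mul_mem_left _ (h2 _ (mem_MI hf hg))
  have triv : ∀ (τ : St K E) (T : Finset E) (d : ℕ), τ.Hom d → τ.ps T ≠ 0 →
      (IsUnit (τ.ps T) ∧ τ.MI T = ⊥) ∨ τ.ps T ∈ τ.MI T := by
    intro τ T d hτ hT
    by_cases hall : ∀ f ∈ T, τ.a T f f = 0
    · left
      constructor
      · obtain ⟨c, hc⟩ := const_of T hall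
        rw [hc] at hT ⊢
        have : c ≠ 0 := by rintro rfl; simp at hT
        exact (isUnit_iff_ne_zero.2 this).map C
      · rw [eq_bot_iff]
        refine MI_le fun f hf g hg => ?_
        rw [loop T τ d hτ f g (hall f hf)]
        exact Ideal.zero_mem _
    · right
      push Not at hall
      obtain ⟨f, hf, hff⟩ := hall
      exact NI_le_MI hf (ps_mem_NI hτ hff)
  rcases triv σ₁ S₁ d₁ h₁ hp1 with ⟨u1, b1⟩ | m1
  · have : σ.MI (S₁ ∪ S₂) = σ₂.MI S₂ := by
      apply le_antisymm
      · apply out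
        · intro x hx
          rw [b1] at hx
          rw [Ideal.mem_bot.1 hx, mul_zero]; exact Ideal.zero_mem _
        · intro x hx
          exact Ideal.mul_mem_left _ _ hx
      · intro x hx
        exact (Ideal.unit_mul_mem_iff_mem _ u1).1 (in2 x hx)
    rwa [this]
  rcases triv σ₂ S₂ d₂ h₂ hp2 with ⟨u2, b2⟩ | m2
  · have : σ.MI (S₁ ∪ S₂) = σ₁.MI S₁ := by
      apply le_antisymm
      · apply out
        · intro x hx
          exact Ideal.mul_mem_left _ _ hx
        · intro x hx
          rw [b2] at hx
          rw [Ideal.mem_bot.1 hx, mul_zero]; exact Ideal.zero_mem _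
      · intro x hx
        exact (Ideal.unit_mul_mem_iff_mem _ u2).1 (in1 x hx)
    rwa [this]
  have r3 := MA.span_pair_radical (σ₁.MA_ps S₁) (σ₂.MA_ps S₂) hd
  have : σ.MI (S₁ ∪ S₂) = σ₁.MI S₁ ⊓ σ₂.MI S₂ ⊓ Ideal.span {σ₁.ps S₁, σ₂.ps S₂} := by
    apply le_antisymm
    · apply out
      · intro x hx
        exact ⟨⟨Ideal.mul_mem_left _ _ hx, Ideal.mul_mem_right _ _ m2⟩,
          Ideal.mul_mem_right _ _ (Ideal.subset_span (by simp))⟩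
      · intro x hx
        exact ⟨⟨Ideal.mul_mem_right _ _ m1, Ideal.mul_mem_left _ _ hx⟩,
          Ideal.mul_mem_right _ _ (Ideal.subset_span (by simp))⟩
    · rintro x ⟨⟨hx1, hx2⟩, hx3⟩
      obtain ⟨u, v, rfl⟩ := Ideal.mem_span_pair.1 hx3
      have hv : v ∈ σ₁.MI S₁ := by
        apply nzd hd r1 (σ₂.MA_ps S₂) hp2
        exact ((σ₁.MI S₁).add_mem_iff_right (Ideal.mul_mem_left _ _ m1)).1 hx1
      have hu : u ∈ σ₂.MI S₂ := by
        apply nzd hd.symm r2 (σ₁.MA_ps S₁) hp1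
        exact ((σ₂.MI S₂).add_mem_iff_left (Ideal.mul_mem_left _ _ m2)).1 hx2
      rw [mul_comm u, mul_comm v]
      exact Ideal.add_mem _ (in2 u hu) (in1 v hv)
  rw [this]
  exact (r1.inf r2).inf r3

variable [Finite E]

theorem MI_rad (n : ℕ) : ∀ (σ : St K E) (d : ℕ) (S : Finset E), S.card = n → σ.Hom d → σ.ps S ≠ 0 →
    (σ.MI S).IsRadical := by
  classical
  induction n using Nat.strong_induction_on with
  | _ n ih =>
  intro σ d S hn h h0
  by_cases hc : σ.Conn S
  · obtain ⟨m, rfl⟩ : ∃ m, n = m + 1 := ⟨n - 1, by have := hc.2.1; omega⟩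
    exact MI_rad_conn m (ih m (by omega)) σ d S hn h hc
  by_cases h2 : S.card ≤ 1
  · rcases Nat.le_one_iff_eq_zero_or_eq_one.1 h2 with h3 | h3
    · rw [Finset.card_eq_zero] at h3
      subst h3
      have : σ.MI ∅ = Ideal.span {C (0:K)} := by
        rw [MI]
        simp
      rw [this]
      exact (MA.const 0).span_radical
    · obtain ⟨e, rfl⟩ := Finset.card_eq_one.1 h3
      have : σ.MI {e} = Ideal.span {σ.a {e} e e} := by
        rw [MI]
        congr 1
        ext p
        simp
      rw [this]
      exact (σ.MA_a _ _ _).span_radical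
  obtain ⟨e, he, f, hf, hef, hz⟩ : ∃ e ∈ S, ∃ f ∈ S, e ≠ f ∧ σ.a S e f = 0 := by
    by_contra hcon
    push Not at hcon
    exact hc ⟨h0, by omega, hcon⟩
  set S₁ := S.filter fun g => g = e ∨ σ.a S e g ≠ 0 with hS1
  set S₂ := S.filter fun g => ¬ (g = e ∨ σ.a S e g ≠ 0) with hS2
  have hd : Disjoint S₁ S₂ := Finset.disjoint_filter_filter_not _ _ _
  have hU : S₁ ∪ S₂ = S := Finset.filter_union_filter_not_eq _ _
  have he1 : e ∈ S₁ := by simp [hS1, he]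
  have hf2 : f ∈ S₂ := by simp [hS2, hf, hz, hef.symm]
  have hcard : S₁.card + S₂.card = S.card := by rw [← Finset.card_union_of_disjoint hd, hU]
  have hc1 : 0 < S₁.card := Finset.card_pos.2 ⟨e, he1⟩
  have hc2 : 0 < S₂.card := Finset.card_pos.2 ⟨f, hf2⟩
  have hcr : ∀ g ∈ S₁, ∀ k ∈ S₂, σ.a S g k = 0 := by
    intro g hg k hk
    simp only [hS1, hS2, Finset.mem_filter, not_or, not_not] at hg hk
    rcases hg.2 with rfl | hg2
    · exact hk.2.2
    · exact (trans_a h0 hg.1 hk.2.2).resolve_left hg2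
  clear_value S₁ S₂
  subst hU
  obtain ⟨σ₁, d₁, h1, hp1, hr1⟩ := separate S₂ hd σ d h h0 hcr
  have hsep2 := separate (S₁ := S₂) S₁ hd.symm σ d h (by rwa [Finset.union_comm])
    (fun f hf g hg => by rw [a_symm, Finset.union_comm]; exact hcr g hg f hf)
  rw [Finset.union_comm] at hsep2
  obtain ⟨σ₂, d₂, h2, hp2, hr2⟩ := hsep2
  obtain ⟨q, hq, hq2⟩ := log_deriv S₁ hd (σ₁.ps S₁) (σ.ps (S₁ ∪ S₂)) (σ₁.MA_ps _) hp1 (σ.MA_ps _) (by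
    intro f hf
    rw [pderiv_ps _ hf, pderiv_ps _ (by simp [hf]), mul_comm]
    exact hr1 f hf f hf)
  have hq0 : q ≠ 0 := by rintro rfl; exact h0 (by rw [hq2, mul_zero])
  obtain ⟨q', hq', hq2'⟩ := log_deriv (S₂ := ∅) S₂ (by simp) (σ₂.ps S₂) q (σ₂.MA_ps _) hp2 (by simpa using hq) (by
    intro f hf
    have h3 := hr2 f hf f hf
    rw [← pderiv_ps _ hf, ← pderiv_ps _ (by simp [hf]), hq2, Derivation.leibniz,
      pderiv_Fr ((σ₁.MA_ps S₁).Fr (Finset.disjoint_right.1 hd hf))] at h3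
    simp only [smul_eq_mul, mul_zero, add_zero] at h3
    apply mul_left_cancel₀ hp1
    linear_combination h3)
  obtain ⟨c, rfl⟩ := hq'.eq_C
  have hc0 : c ≠ 0 := by rintro rfl; exact hq0 (by rw [hq2', map_zero, mul_zero])
  rw [hq2'] at hq2
  refine union_rad h1 h2 hd hp1 hp2 c hc0 ?_ ?_ hcr (ih _ (by omega) σ₁ d₁ S₁ rfl h1 hp1)
    (ih _ (by omega) σ₂ d₂ S₂ rfl h2 hp2)
  · intro f hf g hg
    apply mul_right_cancel₀ hp1
    rw [hr1 f hf g hg, hq2]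
    ring
  · intro f hf g hg
    apply mul_right_cancel₀ hp2
    rw [hr2 f hf g hg, hq2]
    ring

end St
end States
end Config


namespace Config

section Generic
open MvPolynomial Matrix

variable {K : Type} [Field K] {E : Type} [DecidableEq E]

namespace St

/-- functional -/
noncomputable def kap (σ : St K E) (S : Finset E) (q u p : E) : (σ.ι → K) →ₗ[K] MvPolynomial E K where
  toFun x := bf (σ.ZZ S) (σ.vv q) (σ.vv u) (σ.vv p) (C ∘ x)
  map_add' x y := by
    have : ext0 (C ∘ (x + y) : σ.ι → MvPolynomial E K) = ext0 (C ∘ x) + ext0 (C ∘ y) := by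
      funext i
      rcases i with i | i <;> simp [ext0]
    rw [bf, bf, bf, this, af, af, af, Matrix.mulVec_add, dotProduct_add, neg_add]
  map_smul' c x := by
    have : ext0 (C ∘ (c • x) : σ.ι → MvPolynomial E K) = (C c : MvPolynomial E K) • ext0 (C ∘ x) := by
      funext i
      rcases i with i | i <;> simp [ext0]
    rw [bf, bf, this, af, af, Matrix.mulVec_smul, dotProduct_smul, RingHom.id_apply, smul_eq_mul,
      MvPolynomial.smul_eq_C_mul, mul_neg]

lemma kap_v (σ : St K E) (S : Finset E) (q u p h : E) : σ.kap S q u p (σ.v h) = σ.B S q u p h := rfl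

variable {σ : St K E}

lemma beta_apply {ι : Type} [Fintype ι] [DecidableEq ι] (β : (ι → K) →ₗ[K] MvPolynomial E K) (x : ι → K) :
    β x = ∑ i, C (x i) * β (Pi.single i 1) := by
  conv_lhs => rw [pi_eq_sum_univ' x]
  rw [map_sum]
  refine Finset.sum_congr rfl fun i _ => ?_
  rw [map_smul, MvPolynomial.smul_eq_C_mul]

lemma sum_beta (hZ : σ.Z = 0) (S : Finset E) (β : (σ.ι → K) →ₗ[K] MvPolynomial E K) (g : E) :
    ∑ h ∈ S, X h * σ.a S h g * β (σ.v h) = σ.ps S * β (σ.v g) := by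
  have h1 : ∀ i, σ.ps S * C (σ.v g i) = ∑ h ∈ S, X h * C (σ.v h i) * σ.a S h g := by
    intro i
    have := gen (σ := σ) (Pi.single i 1) S g
    rw [hZ, Matrix.zero_mulVec] at this
    have hz : af (σ.ZZ S) (σ.vv g) (C ∘ (0 : σ.ι → K)) = 0 := by
      have : (C ∘ (0 : σ.ι → K) : σ.ι → MvPolynomial E K) = 0 := by funext j; simp
      rw [this, af, Matrix.mulVec_zero, dotProduct_zero]
    rw [hz] at this
    simpa using this
  rw [beta_apply β (σ.v g), Finset.mul_sum]
  simp_rw [← mul_assoc, h1, Finset.sum_mul]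
  rw [Finset.sum_comm]
  refine Finset.sum_congr rfl fun h _ => ?_
  rw [beta_apply β (σ.v h), Finset.mul_sum]
  refine Finset.sum_congr rfl fun i _ => ?_
  ring

lemma sum_kap (hZ : σ.Z = 0) {S : Finset E} (h0 : σ.ps S ≠ 0) (β : (σ.ι → K) →ₗ[K] MvPolynomial E K) (e f : E) :
    ∑ h ∈ S, X h * σ.B S f e f h * β (σ.v h) = σ.a S f f * β (σ.v e) - σ.a S e f * β (σ.v f) := by
  apply mul_left_cancel₀ h0
  rw [mul_sub, mul_left_comm, mul_left_comm (σ.ps S), ← sum_beta hZ, ← sum_beta hZ, Finset.mul_sum, Finset.mul_sum,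
    Finset.mul_sum, ← Finset.sum_sub_distrib]
  refine Finset.sum_congr rfl fun h _ => ?_
  have := σ.ps_mul_B S f e f h
  rw [σ.a_symm S e h, σ.a_symm S f h] at this
  linear_combination X h * β (σ.v h) * this

lemma split (P : Ideal (MvPolynomial E K)) (H : Set E) (κ : (σ.ι → K) →ₗ[K] MvPolynomial E K)
    (hκ : ∀ h ∈ H, κ (σ.v h) ∈ P) : ∃ π : (σ.ι → K) →ₗ[K] MvPolynomial E K,
      (∀ x, π x ∈ P) ∧ ∀ h ∈ H, κ (σ.v h) = π (σ.v h) := by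
  let U := Submodule.span K (σ.v '' H)
  obtain ⟨pr, hpr⟩ := LinearMap.exists_leftInverse_of_injective U.subtype (by simp)
  refine ⟨κ ∘ₗ U.subtype ∘ₗ pr, ?_, ?_⟩
  · intro x
    have hU : U ≤ (P.restrictScalars K).comap κ := by
      rw [Submodule.span_le]
      rintro _ ⟨h, hh, rfl⟩
      exact hκ h hh
    exact hU (pr x).2
  · intro h hh
    have hm : σ.v h ∈ U := Submodule.subset_span ⟨h, hh, rfl⟩
    have := LinearMap.congr_fun hpr ⟨σ.v h, hm⟩
    simp only [LinearMap.comp_apply, Submodule.subtype_apply, LinearMap.id_apply] at this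
    simp [this]

lemma case_two (hZ : σ.Z = 0) {S : Finset E} (h0 : σ.ps S ≠ 0) (P : Ideal (MvPolynomial E K))
    (e f : E) (haee : σ.a S e e ∈ P) (haff : σ.a S f f ∈ P) (haef : σ.a S e f ∈ P)
    (hdis : ∀ h ∈ S, σ.B S f e f h ∈ P ∨ σ.B S e f e h ∈ P) :
    σ.a S e f * σ.B S e f e f ∈ P ^ 2 := by
  obtain ⟨π₁, h1, h1'⟩ := split P {h | σ.B S f e f h ∈ P} (σ.kap S f e f) (fun h hh => hh)
  obtain ⟨π₂, h2, h2'⟩ := split P {h | σ.B S e f e h ∈ P} (σ.kap S e f e) (fun h hh => hh)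
  simp only [kap_v, Set.mem_ofPred_eq] at h1' h2'
  have q12 := sum_kap hZ h0 (σ.kap S e f e) e f
  rw [kap_v, kap_v, B_self_right, mul_zero, zero_sub] at q12
  simp only [kap_v] at q12
  have qk1 := sum_kap hZ h0 π₂ e f
  have qk2 := sum_kap hZ h0 π₁ f e
  have hz : ∑ h ∈ S, X h * (σ.B S f e f h - π₁ (σ.v h)) * (σ.B S e f e h - π₂ (σ.v h)) = 0 := by
    apply Finset.sum_eq_zero
    intro h hh
    rcases hdis h hh with h3 | h3
    · rw [h1' h h3]; ring
    · rw [h2' h h3]; ring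
  have hz2 : ∑ h ∈ S, X h * (σ.B S f e f h - π₁ (σ.v h)) * (σ.B S e f e h - π₂ (σ.v h)) =
      ∑ h ∈ S, X h * σ.B S f e f h * σ.B S e f e h - ∑ h ∈ S, X h * σ.B S f e f h * π₂ (σ.v h)
      - ∑ h ∈ S, X h * σ.B S e f e h * π₁ (σ.v h) + ∑ h ∈ S, X h * (π₁ (σ.v h) * π₂ (σ.v h)) := by
    rw [← Finset.sum_sub_distrib, ← Finset.sum_sub_distrib, ← Finset.sum_add_distrib]
    refine Finset.sum_congr rfl fun h _ => ?_
    ring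
  rw [hz, q12, qk1, qk2] at hz2
  have : σ.a S e f * σ.B S e f e f = - (σ.a S f f * π₂ (σ.v e) - σ.a S e f * π₂ (σ.v f))
      - (σ.a S e e * π₁ (σ.v f) - σ.a S f e * π₁ (σ.v e)) + ∑ h ∈ S, X h * (π₁ (σ.v h) * π₂ (σ.v h)) := by
    linear_combination hz2
  rw [this, pow_two, σ.a_symm S f e]
  refine Ideal.add_mem _ (Ideal.sub_mem _ ((Ideal.neg_mem_iff _).2 (Ideal.sub_mem _ ?_ ?_)) (Ideal.sub_mem _ ?_ ?_))
    (Ideal.sum_mem _ fun h hh => Ideal.mul_mem_left _ _ ?_)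
  all_goals apply Ideal.mul_mem_mul
  all_goals first | assumption | exact h1 _ | exact h2 _

lemma case_one {S : Finset E} (h0 : σ.ps S ≠ 0) (h2 : (2 : K) ≠ 0) (P : Ideal (MvPolynomial E K)) (hP : P.IsPrime)
    (L : Ideal (MvPolynomial E K)) (hL : P ^ 2 ≤ L) (hs : ∀ s x, s ∉ P → s * x ∈ L → x ∈ L)
    (e f g : E) (haee : σ.a S e e ∈ L) (haff : σ.a S f f ∈ L) (hagg : σ.a S g g ∈ L) (haef : σ.a S e f ∈ P)
    (haeg : σ.a S e g ∈ P)
    (hw : σ.B S e g e g ∉ P) (hpf : σ.B S f e f g ∉ P) :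
    σ.a S e f ∈ L := by
  have c1 : σ.B S e f e g * σ.a S e f - σ.B S e f e f * σ.a S e g ∈ L := by
    rw [cross3 h0 e f g f]; exact L.mul_mem_right _ haee
  have c2 : σ.B S f e f g * σ.a S f e - σ.B S f e f e * σ.a S f g ∈ L := by
    rw [cross3 h0 f e g e]; exact L.mul_mem_right _ haff
  have c3 : σ.B S g e g f * σ.a S g e - σ.B S g e g e * σ.a S g f ∈ L := by
    rw [cross3 h0 g e f e]; exact L.mul_mem_right _ hagg
  obtain ⟨c, hc⟩ := af_mul_third (σ.ZZ S) (σ.vv e) (σ.vv g) (σ.vv g) (σ.vv e) (σ.vv f) (σ.vv f)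
  change σ.a S e g * c = σ.B S e g g e * σ.B S e f g f - σ.B S e f g e * σ.B S e g g f at hc
  have r1 : σ.B S e g g e = - σ.B S e g e g := by rw [B_anti_right]
  have r2 : σ.B S e f g f = σ.B S f e f g := by rw [B_anti_left, B_anti_right, neg_neg]
  have r3 : σ.B S e f g e = - σ.B S e f e g := by rw [B_anti_right]
  have r4 : σ.B S e g g f = - σ.B S g e g f := by rw [B_anti_left]
  have r5 : σ.B S g e g e = σ.B S e g e g := by rw [B_anti_left, B_anti_right, neg_neg]
  have r6 : σ.B S f e f e = σ.B S e f e f := by rw [B_anti_left, B_anti_right, neg_neg]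
  rw [r1, r2, r3, r4] at hc
  rw [r5] at c3
  rw [r6] at c2
  rw [σ.a_symm S f e] at c2
  rw [σ.a_symm S g e, σ.a_symm S g f] at c3
  have m1 : σ.a S e g * c * σ.a S e f ∈ L := by
    apply hL
    rw [pow_two]
    exact Ideal.mul_mem_mul (Ideal.mul_mem_right _ _ haeg) haef
  have key : (C 2 * σ.B S e g e g * σ.B S f e f g) * σ.a S e f ∈ L := by
    have : (C 2 * σ.B S e g e g * σ.B S f e f g) * σ.a S e f =
       - (σ.B S g e g f * (σ.B S e f e g * σ.a S e f - σ.B S e f e f * σ.a S e g))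
       + σ.B S e g e g * (σ.B S f e f g * σ.a S e f - σ.B S e f e f * σ.a S f g)
       - σ.B S e f e f * (σ.B S g e g f * σ.a S e g - σ.B S e g e g * σ.a S f g)
       - σ.a S e g * c * σ.a S e f := by
      rw [hc, show (C 2 : MvPolynomial E K) = 2 from map_ofNat C 2]
      ring
    rw [this]
    exact L.sub_mem (L.sub_mem (L.add_mem ((Ideal.neg_mem_iff _).2 (L.mul_mem_left _ c1)) (L.mul_mem_left _ c2))
      (L.mul_mem_left _ c3)) m1
  refine hs _ _ ?_ key
  intro hm
  rcases hP.mem_or_mem hm with hm | hm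
  · rcases hP.mem_or_mem hm with hm | hm
    · exact hP.ne_top (Ideal.eq_top_of_isUnit_mem _ hm ((isUnit_iff_ne_zero.2 h2).map C))
    · exact hw hm
  · exact hpf hm

variable [Finite E]

lemma generic (hZ : σ.Z = 0) {S : Finset E} (h0 : σ.ps S ≠ 0) (h2 : (2 : K) ≠ 0) (P : Ideal (MvPolynomial E K))
    (hP : P ∈ (σ.MI S).minimalPrimes)
    (L : Ideal (MvPolynomial E K)) (hL : P ^ 2 ≤ L) (hs : ∀ s x, s ∉ P → s * x ∈ L → x ∈ L)
    (hd : ∀ e ∈ S, σ.a S e e ∈ L) {e0 f0 : E} (he0 : e0 ∈ S) (hf0 : f0 ∈ S) (hne : σ.a S e0 f0 ≠ 0) : σ.MI S ≤ L := by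
  obtain ⟨e, he, f, hf, g, hg, hB⟩ := exists_B_MI P hP he0 hf0 hne
  have hPp := hP.1.1
  have hle := hP.1.2
  obtain ⟨c, hc⟩ := af_mul_third (σ.ZZ S) (σ.vv e) (σ.vv e) (σ.vv f) (σ.vv f) (σ.vv g) (σ.vv g)
  change σ.a S e e * c = σ.B S e f e f * σ.B S e g e g - σ.B S e g e f * σ.B S e f e g at hc
  rw [σ.B_transpose S e g e f] at hc
  have huw : σ.B S e f e f * σ.B S e g e g ∉ P := by
    intro hm
    have h3 : σ.B S e f e g * σ.B S e f e g ∈ P := by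
      have : σ.B S e f e g * σ.B S e f e g = σ.B S e f e f * σ.B S e g e g - σ.a S e e * c := by rw [hc]; ring
      rw [this]
      exact P.sub_mem hm (P.mul_mem_right _ (hle (mem_MI he he)))
    rcases hPp.mem_or_mem h3 with h | h <;> exact hB h
  have hu : σ.B S e f e f ∉ P := fun h => huw (P.mul_mem_right _ h)
  have haef : σ.a S e f ∈ L := by
    by_cases hex : ∃ k ∈ S, σ.B S f e f k ∉ P ∧ σ.B S e f e k ∉ P
    · obtain ⟨k, hk, hk1, hk2⟩ := hex
      refine case_one h0 h2 P hPp L hL hs e f k (hd e he) (hd f hf) (hd k hk) (hle (mem_MI he hf))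
        (hle (mem_MI he hk)) ?_ hk1
      intro hm
      obtain ⟨c, hc⟩ := af_mul_third (σ.ZZ S) (σ.vv e) (σ.vv e) (σ.vv f) (σ.vv f) (σ.vv k) (σ.vv k)
      change σ.a S e e * c = σ.B S e f e f * σ.B S e k e k - σ.B S e k e f * σ.B S e f e k at hc
      rw [σ.B_transpose S e k e f] at hc
      have h3 : σ.B S e f e k * σ.B S e f e k ∈ P := by
        have : σ.B S e f e k * σ.B S e f e k = σ.B S e f e f * σ.B S e k e k - σ.a S e e * c := by rw [hc]; ring
        rw [this]
        exact P.sub_mem (P.mul_mem_left _ hm) (P.mul_mem_right _ (hle (mem_MI he he)))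
      rcases hPp.mem_or_mem h3 with h | h <;> exact hk2 h
    · push Not at hex
      apply hs _ _ hu
      rw [mul_comm]
      apply hL
      refine case_two hZ h0 P e f (hle (mem_MI he he)) (hle (mem_MI hf hf)) (hle (mem_MI he hf)) ?_
      intro k hk
      by_cases h3 : σ.B S f e f k ∈ P
      · exact Or.inl h3
      · exact Or.inr (by simpa using hex k hk h3)
  have key : ∀ h, σ.a S e h ∈ L := by
    intro h
    apply hs _ _ hu
    rw [eq_add_of_sub_eq (cross3 h0 e f f h)]
    exact L.add_mem (L.mul_mem_right _ (hd e he)) (L.mul_mem_left _ haef)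
  refine MI_le fun k hk l hl => ?_
  apply hs _ _ hu
  rw [eq_add_of_sub_eq (cross2 h0 e f f k l)]
  exact L.add_mem (L.add_mem (L.mul_mem_right _ (key k)) (L.mul_mem_right _ (key f))) (L.mul_mem_left _ (hd f hf))

end St
end Generic
end Config

open scoped BigOperators

namespace Config

variable {K : Type} [Field K] {E : Type} [Fintype E] [DecidableEq E]

/-- `w` is a (linear) basis of the configuration `W ⊆ K^E`. -/
def IsBasisOf {r : ℕ} (w : Fin r → E → K) (W : Submodule K (E → K)) : Prop :=
  LinearIndependent K w ∧ Submodule.span K (Set.range w) = W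

/-- The configuration (bilinear) form `Q_W` computed from the basis `w`: the symmetric
`r × r` matrix with entries `∑_{e ∈ E} x_e · w^i_e · w^j_e` over `K[x_e : e ∈ E]`. -/
noncomputable def Qform {r : ℕ} (w : Fin r → E → K) :
    Matrix (Fin r) (Fin r) (MvPolynomial E K) :=
  Matrix.of fun i j => ∑ e : E, MvPolynomial.C (w i e * w j e) * MvPolynomial.X e

/-- The coefficient `c_{W,B} = (det (w^i_e)_{1≤i≤r, e∈B})²`, the squared determinant of
the `r × r` submatrix of the coefficient matrix of `w` with column set `B` (the square
is independent of the chosen ordering of the columns). -/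
noncomputable def cSq {r : ℕ} (w : Fin r → E → K) (B : Finset E) : K :=
  if h : B.card = r then
    (Matrix.det (Matrix.of fun i j : Fin r =>
      w i ((Finset.equivFinOfCardEq h).symm j : E))) ^ 2
  else 0

/-- The configuration polynomial `ψ_W = ∑_B c_{W,B} · x^B` computed from the basis `w`
(the coefficient `c_{W,B}` vanishes unless `B` is a basis of the matroid `M_W`). -/
noncomputable def psi {r : ℕ} (w : Fin r → E → K) : MvPolynomial E K :=
  ∑ B ∈ Finset.univ.powersetCard r,
    MvPolynomial.C (cSq w B) * ∏ e ∈ B, MvPolynomial.X e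

/-- The ideal `M_W` generated by the submaximal, i.e. `(r−1) × (r−1)`, minors of the
configuration form `Q_W`. -/
noncomputable def minorIdeal {r : ℕ} (w : Fin r → E → K) : Ideal (MvPolynomial E K) :=
  Ideal.span {p | ∃ f g : Fin (r - 1) ↪ Fin r, p = Matrix.det ((Qform w).submatrix f g)}

/-- The Jacobian ideal `J_W = ⟨ψ_W⟩ + ⟨∂ψ_W/∂x_e : e ∈ E⟩`. -/
noncomputable def jacIdeal {r : ℕ} (w : Fin r → E → K) : Ideal (MvPolynomial E K) :=
  Ideal.span ({psi w} ∪ Set.range fun e => MvPolynomial.pderiv e (psi w))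

end Config


namespace Config

section Final
open MvPolynomial Matrix

variable {K : Type} [Field K] {E : Type} [Fintype E] [DecidableEq E]

/-- the state attached to a family of vectors -/
abbrev st {r : ℕ} (w : Fin r → E → K) : St K E where
  ι := Fin r
  Z := 0
  symm := by simp [Matrix.IsSymm]
  v e i := w i e

/-- partial configuration form -/
noncomputable def Qm {r : ℕ} (w : Fin r → E → K) (S : Finset E) : Matrix (Fin r) (Fin r) (MvPolynomial E K) :=
  Matrix.of fun i j => ∑ e ∈ S, C (w i e * w j e) * X e

lemma Qm_univ {r : ℕ} (w : Fin r → E → K) : Qm w Finset.univ = Qform w := rfl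

lemma Qm_eq {r : ℕ} (w : Fin r → E → K) (S : Finset E) : (0 : Matrix (Fin r) (Fin r) K).map C +
    ∑ e ∈ S, (X e : MvPolynomial E K) • vecMulVec (C ∘ (fun i => w i e)) (C ∘ (fun i => w i e)) = Qm w S := by
  refine Matrix.ext fun i j => ?_
  rw [Matrix.add_apply, Matrix.sum_apply, Matrix.map_apply, Matrix.zero_apply, map_zero, zero_add]
  refine Finset.sum_congr rfl fun e _ => ?_
  rw [Matrix.smul_apply, vecMulVec_apply, smul_eq_mul, mul_comm, C_mul]
  rfl

lemma st_ZZ {r : ℕ} (w : Fin r → E → K) (S : Finset E) : (st w).ZZ S = Qm w S := Qm_eq w S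

lemma st_ps {r : ℕ} (w : Fin r → E → K) (S : Finset E) : (st w).ps S = (Qm w S).det := by
  rw [St.ps, st_ZZ]

lemma st_a {r : ℕ} (w : Fin r → E → K) (S : Finset E) (f g : E) :
    (st w).a S f g = ∑ i : Fin r, C (w i f) * ∑ j : Fin r, (Qm w S).adjugate i j * C (w j g) := by
  rw [St.a, st_ZZ]
  rfl

lemma det_homog {n : ℕ} (M : Matrix (Fin n) (Fin n) (MvPolynomial E K)) (h : ∀ i j, (M i j).IsHomogeneous 1) :
    M.det.IsHomogeneous n := by
  rw [Matrix.det_apply]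
  refine IsHomogeneous.sum _ _ _ fun s _ => ?_
  have h1 : (∏ i, M (s i) i).IsHomogeneous (∑ i : Fin n, 1) :=
    IsHomogeneous.prod _ _ _ fun i _ => h _ _
  have h2 : (∑ i : Fin n, 1) = n := by simp
  rw [h2] at h1
  rcases Int.units_eq_one_or (Equiv.Perm.sign s) with hs | hs
  · rw [hs, one_smul]; exact h1
  · rw [hs, Units.neg_smul, one_smul]; exact h1.neg

lemma Qm_homog {r : ℕ} (w : Fin r → E → K) (S : Finset E) (i j : Fin r) :
    (Qm w S i j).IsHomogeneous 1 := by
  rw [Qm, Matrix.of_apply]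
  refine IsHomogeneous.sum _ _ _ fun e _ => ?_
  have := (isHomogeneous_C E (w i e * w j e)).mul (isHomogeneous_X K e)
  simpa using this

lemma st_a_zero (w : Fin 0 → E → K) (S : Finset E) (f g : E) : (st w).a S f g = 0 := by
  rw [st_a]; exact Finset.sum_empty

lemma st_hom {r : ℕ} (w : Fin r → E → K) : (st w).Hom r := by
  refine ⟨fun S => ?_, ?_, ?_⟩
  · rw [st_ps]; exact det_homog _ (Qm_homog w S)
  · intro S f g
    rcases r with _ | m
    · rw [st_a_zero]; exact isHomogeneous_zero _ _ _
    · have h1 : ∀ i j, ((Qm w S).adjugate i j).IsHomogeneous m := by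
        intro i j
        rw [Matrix.adjugate_fin_succ_eq_det_submatrix]
        have h2 : ((-1 : MvPolynomial E K) ^ ((j : ℕ) + (i : ℕ))).IsHomogeneous 0 := by
          rcases neg_one_pow_eq_or (MvPolynomial E K) ((j : ℕ) + (i : ℕ)) with h | h
          · rw [h]; exact isHomogeneous_one _ _
          · rw [h]; exact (isHomogeneous_one _ _).neg
        have := h2.mul (det_homog ((Qm w S).submatrix j.succAbove i.succAbove)
          fun i j => Qm_homog w S _ _)
        simpa using this
      rw [st_a]
      refine IsHomogeneous.sum _ _ _ fun i _ => ?_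
      have h3 : (∑ j : Fin (m+1), (Qm w S).adjugate i j * C (w j g)).IsHomogeneous m := by
        refine IsHomogeneous.sum _ _ _ fun j _ => ?_
        simpa using (h1 i j).mul (isHomogeneous_C E (w j g))
      simpa using (isHomogeneous_C E (w i f)).mul h3
  · intro hr S f g
    subst hr
    exact st_a_zero w S f g

lemma eval_ps {r : ℕ} (w : Fin r → E → K) (B : Finset E) (b : Fin r ≃ B) :
    eval (fun e => if e ∈ B then (1 : K) else 0) ((st w).ps Finset.univ) =
      (Matrix.det (Matrix.of fun i j : Fin r => w i (b j : E))) ^ 2 := by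
  rw [st_ps, RingHom.map_det, pow_two]
  conv_rhs => rhs; rw [← Matrix.det_transpose]
  rw [← Matrix.det_mul]
  congr 1
  refine Matrix.ext fun i j => ?_
  rw [RingHom.mapMatrix_apply, Matrix.map_apply, Matrix.mul_apply]
  simp only [Qm, Matrix.of_apply, map_sum, map_mul, eval_C, eval_X, Matrix.transpose_apply]
  rw [b.sum_comp (fun e : B => w i e * w j e), Finset.sum_coe_sort B (fun e => w i e * w j e)]
  simp

lemma ps_ne_zero {r : ℕ} (w : Fin r → E → K) (hw : LinearIndependent K w) :
    (st w).ps Finset.univ ≠ 0 ∧ Submodule.span K (Set.range (fun e i => w i e)) = (⊤ : Submodule K (Fin r → K)) := by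
  have hsp : Submodule.span K (Set.range (fun e i => w i e)) = (⊤ : Submodule K (Fin r → K)) := by
    rw [eq_top_iff]
    intro x _
    by_contra hx
    obtain ⟨κ, h1, h2⟩ := St.exists_sep _ _ hx
    have : ∑ i, κ i • w i = 0 := by
      funext e
      have := h2 _ (Submodule.subset_span ⟨e, rfl⟩)
      rw [Finset.sum_apply]
      simpa [dotProduct, mul_comm] using this
    have h3 := Fintype.linearIndependent_iff.1 hw κ this
    have : κ = 0 := funext h3
    rw [this, dotProduct_zero] at h1
    exact zero_ne_one h1
  refine ⟨?_, hsp⟩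
  obtain ⟨ι, a, ha, hs, hl⟩ := exists_linearIndependent' K (fun (e : E) (i : Fin r) => w i e)
  rw [hsp] at hs
  have : Finite ι := Finite.of_injective a ha
  have := Fintype.ofFinite ι
  let bs := Module.Basis.mk hl hs.ge
  have hc : Fintype.card ι = r := by
    rw [← Module.finrank_eq_card_basis bs]; simp
  let q : Fin r ≃ ι := (Fintype.equivFinOfCardEq hc).symm
  let b : Fin r ≃ (Finset.univ.image a : Finset E) :=
    Equiv.ofBijective (fun i => ⟨a (q i), by simp⟩) ⟨by
      intro i j h
      simp only [Subtype.mk.injEq] at h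
      exact q.injective (ha h), by
      rintro ⟨e, he⟩
      simp only [Finset.mem_image, Finset.mem_univ, true_and] at he
      obtain ⟨i, rfl⟩ := he
      exact ⟨q.symm i, by simp⟩⟩
  have hev := eval_ps w _ b
  intro h0
  rw [h0, map_zero] at hev
  have hl2 : LinearIndependent K (Matrix.of fun i j : Fin r => w i (b j : E)).col := by
    have := hl.comp q q.injective
    exact this
  rw [Matrix.linearIndependent_cols_iff_isUnit, Matrix.isUnit_iff_isUnit_det] at hl2
  exact hl2.ne_zero (pow_eq_zero_iff two_ne_zero |>.1 hev.symm)

lemma MA_zero_of_eval (S : Finset E) : ∀ (r : ℕ) (p : MvPolynomial E K), MA S p → p.IsHomogeneous r →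
    (∀ B ⊆ S, B.card = r → eval (fun e => if e ∈ B then (1 : K) else 0) p = 0) → p = 0 := by
  induction S using Finset.induction_on with
  | empty =>
    intro r p hp hr h
    obtain ⟨c, rfl⟩ := hp.eq_C
    rcases Nat.eq_zero_or_pos r with rfl | hr0
    · have := h ∅ (by simp) (by simp)
      rw [eval_C] at this
      rw [this, map_zero]
    · exact St.eq_zero_of_homog hr (isHomogeneous_C E c) (by omega)
  | insert e S he ih =>
    intro r p hp hr hev
    obtain ⟨f, g, hf, hg, hpe⟩ := hp.decomp (Finset.mem_insert_self e S)
    rw [Finset.erase_insert he] at hf hg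
    have evFr : ∀ (q : MvPolynomial E K), MA S q → ∀ B ⊆ S,
      eval (fun x => if x ∈ insert e B then (1 : K) else 0) q = eval (fun x => if x ∈ B then (1 : K) else 0) q := by
      intro q hq B hB
      have hFr := hq.Fr he
      unfold Fr supported at hFr
      clear hq
      induction hFr using Algebra.adjoin_induction with
      | mem x hx =>
        obtain ⟨g, hg, rfl⟩ := hx
        have : g ≠ e := by simpa using hg
        rw [eval_X, eval_X]
        simp [this]
      | algebraMap r => rw [MvPolynomial.algebraMap_eq, eval_C, eval_C]
      | add x y _ _ hx hy => rw [map_add, hx, hy, map_add]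
      | mul x y _ _ hx hy => rw [map_mul, hx, hy, map_mul]
    have hgh : g.IsHomogeneous r := by
      intro m hm
      have hme : m e = 0 := by
        by_contra hne
        have hFr := hg.Fr he
        rw [Config.Fr, mem_supported] at hFr
        have h3 : e ∈ g.vars := by
          rw [mem_vars]
          exact ⟨m, by rwa [mem_support_iff], by simpa using hne⟩
        exact hFr h3 rfl
      refine hr (d := m) ?_
      rw [hpe, coeff_add, mul_comm, coeff_mul_X', if_neg (by simp [hme]), zero_add]
      exact hm
    have hg0 : g = 0 := by
      refine ih r g hg hgh fun B hB hc => ?_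
      have := hev B (hB.trans (Finset.subset_insert _ _)) hc
      rw [hpe, map_add, map_mul, eval_X, if_neg (fun h => he (hB h)), zero_mul, zero_add] at this
      exact this
    have hXf : p = X e * f := by rw [hpe, hg0, add_zero]
    rw [hXf] at hr hev ⊢
    rcases r with _ | r
    · rw [St.zero_of_X_mul hr, mul_zero]
    · have hf0 : f = 0 := by
        refine ih r f hf (St.homog_of_X_mul hr) fun B hB hc => ?_
        have := hev (insert e B) (Finset.insert_subset_insert _ hB) (by
          rw [Finset.card_insert_of_notMem (fun h => he (hB h)), hc])
        rw [map_mul, eval_X, if_pos (Finset.mem_insert_self _ _), one_mul, evFr f hf B hB] at this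
        exact this
      rw [hf0, mul_zero]

end Final
end Config

namespace Config

section Final2
open MvPolynomial Matrix

variable {K : Type} [Field K] {E : Type} [Fintype E] [DecidableEq E]

lemma MA_prod (B : Finset E) : MA B (∏ e ∈ B, X e : MvPolynomial E K) := by
  induction B using Finset.induction_on with
  | empty => simpa using MA.const (E := E) (1 : K)
  | insert e B he ih =>
    rw [Finset.prod_insert he]
    simpa using MA.step B e he _ _ ih (MA.zero B)

lemma MA_sum {α : Type} (S : Finset E) (s : Finset α) (p : α → MvPolynomial E K) (h : ∀ i ∈ s, MA S (p i)) :
    MA S (∑ i ∈ s, p i) := by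
  classical
  induction s using Finset.induction_on with
  | empty => simpa using MA.zero S
  | insert a s ha ih =>
    rw [Finset.sum_insert ha]
    exact (h _ (Finset.mem_insert_self _ _)).add (ih fun i hi => h i (Finset.mem_insert_of_mem hi))

lemma eval_psi {r : ℕ} (w : Fin r → E → K) (B : Finset E) (hB : B.card = r) :
    eval (fun e => if e ∈ B then (1 : K) else 0) (psi w) = cSq w B := by
  rw [psi, map_sum, Finset.sum_eq_single B]
  · rw [map_mul, eval_C, map_prod, Finset.prod_eq_one, mul_one]
    intro e he
    rw [eval_X, if_pos he]
  · intro B' hB' hne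
    rw [Finset.mem_powersetCard] at hB'
    have : ∃ e ∈ B', e ∉ B := by
      by_contra hcon
      push Not at hcon
      exact hne (Finset.eq_of_subset_of_card_le hcon (by omega))
    obtain ⟨e, he, he'⟩ := this
    rw [map_mul, map_prod, Finset.prod_eq_zero he, mul_zero]
    rw [eval_X, if_neg he']
  · intro h
    exact absurd (Finset.mem_powersetCard.2 ⟨Finset.subset_univ _, hB⟩) h

lemma psi_eq {r : ℕ} (w : Fin r → E → K) : psi w = (st w).ps Finset.univ := by
  rw [← sub_eq_zero]
  refine MA_zero_of_eval Finset.univ r _ ?_ ?_ ?_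
  · rw [sub_eq_add_neg]
    refine MA.add ?_ ((St.MA_ps _ _).neg)
    refine MA_sum _ _ _ fun B _ => ?_
    exact ((MA_prod B).mono (Finset.subset_univ _)).smul _
  · refine IsHomogeneous.sub ?_ ((st_hom w).1 _)
    refine IsHomogeneous.sum _ _ _ fun B hB => ?_
    have h1 : (∏ e ∈ B, X e : MvPolynomial E K).IsHomogeneous (∑ e ∈ B, 1) :=
      IsHomogeneous.prod _ _ _ fun e _ => isHomogeneous_X K e
    have h2 : ∑ e ∈ B, 1 = r := by
      rw [Finset.sum_const, (Finset.mem_powersetCard.1 hB).2]; simp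
    rw [h2] at h1
    simpa using (isHomogeneous_C E (cSq w B)).mul h1
  · intro B _ hB
    rw [map_sub, eval_psi w B hB, eval_ps w B (Finset.equivFinOfCardEq hB).symm, cSq, dif_pos hB, sub_self]

lemma jac_eq {r : ℕ} (w : Fin r → E → K) : jacIdeal w =
    Ideal.span ({(st w).ps Finset.univ} ∪ Set.range fun e => (st w).a Finset.univ e e) := by
  rw [jacIdeal, psi_eq]
  simp only [St.pderiv_ps (st w) (Finset.mem_univ _)]

lemma minor_zero (w : Fin 0 → E → K) : minorIdeal w = ⊤ := by
  rw [Ideal.eq_top_iff_one]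
  refine Ideal.subset_span ⟨Function.Embedding.refl (Fin 0), Function.Embedding.refl (Fin 0), ?_⟩
  have : IsEmpty (Fin (0 - 1)) := inferInstanceAs (IsEmpty (Fin 0))
  rw [Matrix.det_isEmpty]

lemma jac_zero (w : Fin 0 → E → K) : jacIdeal w = ⊤ := by
  rw [Ideal.eq_top_iff_one, jac_eq]
  refine Ideal.subset_span (Or.inl ?_)
  rw [st_ps, Matrix.det_isEmpty]; rfl

lemma emb_form {m : ℕ} (f : Fin m ↪ Fin (m+1)) : ∃ (i : Fin (m+1)) (s : Equiv.Perm (Fin m)), ∀ j, f j = i.succAbove (s j) := by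
  have : ∃ i, ∀ j, f j ≠ i := by
    by_contra hcon
    push Not at hcon
    have := Fintype.card_le_of_surjective f hcon
    simp at this
  obtain ⟨i, hi⟩ := this
  choose g hg using fun j => Fin.exists_succAbove_eq (hi j)
  have hinj : Function.Injective g := by
    intro a b h
    apply f.injective
    rw [← hg, ← hg, h]
  exact ⟨i, Equiv.ofBijective g (Finite.injective_iff_bijective.1 hinj), fun j => (hg j).symm⟩

lemma minor_eq {m : ℕ} (w : Fin (m+1) → E → K) (hw : LinearIndependent K w) :
    minorIdeal w = (st w).MI Finset.univ := by
  obtain ⟨h0, hsp⟩ := ps_ne_zero w hw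
  apply le_antisymm
  · -- adjugate entries lie in MI
    have hadj : ∀ i j, (Qform w).adjugate i j ∈ (st w).MI Finset.univ := by
      have key : ∀ x y : Fin (m+1) → K, af (Qform w) (C ∘ x) (C ∘ y) ∈ (st w).MI Finset.univ := by
        intro x
        have hx : x ∈ Submodule.span K (Set.range (fun e i => w i e)) := hsp ▸ Submodule.mem_top
        induction hx using Submodule.span_induction with
        | mem x hx =>
          obtain ⟨e, rfl⟩ := hx
          intro y
          have hy : y ∈ Submodule.span K (Set.range (fun e i => w i e)) := hsp ▸ Submodule.mem_top
          induction hy using Submodule.span_induction with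
          | mem y hy =>
            obtain ⟨f, rfl⟩ := hy
            have := St.mem_MI (σ := st w) (Finset.mem_univ e) (Finset.mem_univ f)
            rw [St.a, st_ZZ, Qm_univ] at this
            exact this
          | zero =>
            have : (C ∘ (0 : Fin (m+1) → K) : Fin (m+1) → MvPolynomial E K) = 0 := by funext j; simp
            rw [this, af, Matrix.mulVec_zero, dotProduct_zero]; exact Ideal.zero_mem _
          | add x y _ _ hx hy =>
            have : (C ∘ (x + y) : Fin (m+1) → MvPolynomial E K) = C ∘ x + C ∘ y := by funext j; simp
            rw [this, af, Matrix.mulVec_add, dotProduct_add]; exact Ideal.add_mem _ hx hy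
          | smul c x _ hx =>
            have : (C ∘ (c • x) : Fin (m+1) → MvPolynomial E K) = (C c : MvPolynomial E K) • (C ∘ x) := by funext j; simp
            rw [this, af, Matrix.mulVec_smul, dotProduct_smul]; exact Ideal.mul_mem_left _ _ hx
        | zero =>
          intro y
          have : (C ∘ (0 : Fin (m+1) → K) : Fin (m+1) → MvPolynomial E K) = 0 := by funext j; simp
          rw [this, af, zero_dotProduct]; exact Ideal.zero_mem _
        | add x y _ _ hx hy =>
          intro z
          have : (C ∘ (x + y) : Fin (m+1) → MvPolynomial E K) = C ∘ x + C ∘ y := by funext j; simp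
          rw [this, af, add_dotProduct]; exact Ideal.add_mem _ (hx z) (hy z)
        | smul c x _ hx =>
          intro z
          have : (C ∘ (c • x) : Fin (m+1) → MvPolynomial E K) = (C c : MvPolynomial E K) • (C ∘ x) := by funext j; simp
          rw [this, af, smul_dotProduct]; exact Ideal.mul_mem_left _ _ (hx z)
      intro i j
      have := key (Pi.single i 1) (Pi.single j 1)
      have hs : ∀ i : Fin (m+1), (C ∘ (Pi.single i 1 : Fin (m+1) → K) : Fin (m+1) → MvPolynomial E K) = Pi.single i 1 := by
        intro i
        funext j
        by_cases h : j = i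
        · subst h; simp
        · simp [h]
      rw [hs, hs, af, single_one_dotProduct, Matrix.mulVec_single_one] at this
      exact this
    rw [minorIdeal, Ideal.span_le]
    rintro _ ⟨f, g, rfl⟩
    obtain ⟨i, s, hs⟩ := emb_form f
    obtain ⟨j, t, ht⟩ := emb_form g
    have h1 : (Qform w).submatrix f g = (((Qform w).submatrix i.succAbove j.succAbove).submatrix s id).submatrix id t := by
      refine Matrix.ext fun a b => ?_
      simp only [Matrix.submatrix_apply, id]
      rw [hs, ht]
    have h2 := hadj j i
    rw [Matrix.adjugate_fin_succ_eq_det_submatrix] at h2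
    have h3 : ((Qform w).submatrix i.succAbove j.succAbove).det ∈ (st w).MI Finset.univ := by
      rcases neg_one_pow_eq_or (MvPolynomial E K) ((i : ℕ) + (j : ℕ)) with h | h
      · rw [h, one_mul] at h2; exact h2
      · rw [h, neg_one_mul, Ideal.neg_mem_iff] at h2; exact h2
    rw [SetLike.mem_coe, h1, Matrix.det_permute', Matrix.det_permute]
    exact Ideal.mul_mem_left _ _ (Ideal.mul_mem_left _ _ h3)
  · refine St.MI_le fun f _ g _ => ?_
    rw [st_a, Qm_univ]
    refine Ideal.sum_mem _ fun i _ => Ideal.mul_mem_left _ _ (Ideal.sum_mem _ fun j _ => Ideal.mul_mem_right _ _ ?_)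
    rw [Matrix.adjugate_fin_succ_eq_det_submatrix]
    refine Ideal.mul_mem_left _ _ (Ideal.subset_span ?_)
    exact ⟨j.succAboveEmb, i.succAboveEmb, rfl⟩

lemma exists_ne {m : ℕ} (w : Fin (m+1) → E → K) (hw : LinearIndependent K w) :
    ∃ e, (st w).a Finset.univ e e ≠ 0 := by
  obtain ⟨h0, hsp⟩ := ps_ne_zero w hw
  by_contra hcon
  push Not at hcon
  obtain ⟨c, hc⟩ := St.const_of (σ := st w) Finset.univ fun f _ => hcon f
  have h1 := (st_hom w).1 Finset.univ
  exact h0 (St.eq_zero_of_homog h1 (by rw [hc]; exact isHomogeneous_C E c) (by omega))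

lemma jac_rad {m : ℕ} (w : Fin (m+1) → E → K) (hw : LinearIndependent K w) :
    (st w).MI Finset.univ = (jacIdeal w).radical ∧ jacIdeal w ≤ (st w).MI Finset.univ := by
  obtain ⟨h0, hsp⟩ := ps_ne_zero w hw
  obtain ⟨e, he⟩ := exists_ne w hw
  have hle : jacIdeal w ≤ (st w).MI Finset.univ := by
    rw [jac_eq, Ideal.span_le]
    rintro x (hx | ⟨f, rfl⟩)
    · rw [hx]
      exact St.NI_le_MI (Finset.mem_univ e) (St.ps_mem_NI (st_hom w) he)
    · exact St.mem_MI (Finset.mem_univ f) (Finset.mem_univ f)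
  have hps : (st w).ps Finset.univ ∈ jacIdeal w := by
    rw [jac_eq]; exact Ideal.subset_span (Or.inl rfl)
  have haa : ∀ f, (st w).a Finset.univ f f ∈ jacIdeal w := by
    intro f
    rw [jac_eq]; exact Ideal.subset_span (Or.inr ⟨f, rfl⟩)
  refine ⟨le_antisymm ?_ ?_, hle⟩
  · refine St.MI_le fun f _ g _ => ?_
    refine ⟨2, ?_⟩
    have h1 := (st w).ps_mul_B Finset.univ f g f g
    rw [(st w).a_symm Finset.univ g f] at h1
    have h2 : (st w).a Finset.univ f g ^ 2 = (st w).a Finset.univ f f * (st w).a Finset.univ g g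
        - (st w).ps Finset.univ * (st w).B Finset.univ f g f g := by
      linear_combination h1
    rw [h2]
    exact Ideal.sub_mem _ (Ideal.mul_mem_right _ _ (haa f)) (Ideal.mul_mem_right _ _ hps)
  · exact (St.MI_rad _ (st w) _ Finset.univ rfl (st_hom w) h0).radical_le_iff.2 hle

/-- local statement -/
lemma loc_reduced {R : Type} [CommRing R] [IsNoetherianRing R] (J M P : Ideal R) (hP : P.IsPrime) (hJM : J ≤ M)
    (hM : M.IsRadical) (hmin : P ∈ M.minimalPrimes)
    (H : ∀ L : Ideal R, P ^ 2 ≤ L → (∀ s x, s ∉ P → s * x ∈ L → x ∈ L) → J ≤ L → M ≤ L) :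
    IsReduced (Localization.AtPrime P ⧸ J.map (algebraMap R (Localization.AtPrime P))) := by
  set A := Localization.AtPrime P
  have hm : P.map (algebraMap R A) = IsLocalRing.maximalIdeal A := Localization.AtPrime.map_eq_maximalIdeal
  have hMm : IsLocalRing.maximalIdeal A ≤ M.map (algebraMap R A) := by
    have h1 := IsLocalization.AtPrime.radical_map_of_mem_minimalPrimes (A := A) P M hmin
    have h2 := IsLocalization.map_radical P.primeCompl A M
    rw [hM.radical] at h2
    rw [← hm, ← h1, ← h2]
  have hML : M.map (algebraMap R A) ≤ J.map (algebraMap R A) ⊔ IsLocalRing.maximalIdeal A ^ 2 := by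
    rw [Ideal.map_le_iff_le_comap]
    apply H
    · rw [← Ideal.map_le_iff_le_comap, Ideal.map_pow, hm]
      exact le_sup_right
    · intro s x hs hx
      rw [Ideal.mem_comap, map_mul] at hx
      have hu : IsUnit (algebraMap R A s) := IsLocalization.map_units A (⟨s, hs⟩ : P.primeCompl)
      exact (Ideal.unit_mul_mem_iff_mem _ hu).1 hx
    · rw [← Ideal.map_le_iff_le_comap]; exact le_sup_left
  have hJ : J.map (algebraMap R A) = IsLocalRing.maximalIdeal A := by
    apply le_antisymm
    · rw [← hm]; exact Ideal.map_mono (hJM.trans hmin.1.2)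
    · refine Submodule.le_of_le_smul_of_le_jacobson_bot (I := IsLocalRing.maximalIdeal A)
        (IsNoetherian.noetherian _) (IsLocalRing.maximalIdeal_le_jacobson _) ?_
      rw [smul_eq_mul, ← pow_two]
      exact hMm.trans hML
  rw [hJ]
  infer_instance

lemma main {r : ℕ} (w : Fin r → E → K) (hw : LinearIndependent K w) :
    (minorIdeal w).radical = minorIdeal w ∧
    minorIdeal w = (jacIdeal w).radical ∧
    (ringChar K ≠ 2 →
      ∀ p ∈ (jacIdeal w).minimalPrimes, ∀ (hp : p.IsPrime),
        IsReduced ((Localization.AtPrime p (hp := hp)) ⧸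
          Ideal.map (algebraMap (MvPolynomial E K) (Localization.AtPrime p (hp := hp)))
            (jacIdeal w))) := by
  rcases r with _ | m
  · rw [minor_zero, jac_zero]
    refine ⟨Ideal.radical_top _, (Ideal.radical_top _).symm, ?_⟩
    intro _ p hp hpp
    exact absurd (top_le_iff.1 hp.1.2) hpp.ne_top
  · obtain ⟨h0, hsp⟩ := ps_ne_zero w hw
    obtain ⟨h1, h2⟩ := jac_rad w hw
    have hr := St.MI_rad _ (st w) _ Finset.univ rfl (st_hom w) h0
    rw [minor_eq w hw]
    refine ⟨hr.radical, h1, ?_⟩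
    intro hc p hp hpp
    have hp' : p ∈ ((st w).MI Finset.univ).minimalPrimes := by
      rw [h1, Ideal.radical_minimalPrimes]; exact hp
    obtain ⟨e, he⟩ := exists_ne w hw
    refine loc_reduced (jacIdeal w) ((st w).MI Finset.univ) p hpp h2 hr hp' ?_
    intro L hL hs hJ
    refine St.generic rfl h0 (Ring.two_ne_zero hc) p hp' L hL hs (fun f _ => hJ ?_) (Finset.mem_univ e) (Finset.mem_univ e) he
    rw [jac_eq]; exact Ideal.subset_span (Or.inr ⟨f, rfl⟩)

end Final2
end Config

namespace Config

variable {K : Type} [Field K] {E : Type} [Fintype E] [DecidableEq E]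

/-- **Theorem (Reducedness).**
For any configuration `W ⊆ K^E`, the ideal `M_W` of submaximal minors of `Q_W` is a
radical ideal and equals the radical of the Jacobian ideal `J_W`; if moreover
`char K ≠ 2`, then `K[x]/J_W` is generically reduced: its localization at every
minimal prime over `J_W` is reduced. -/
theorem minorIdeal_radical_and_generically_reduced
    (W : Submodule K (E → K)) {r : ℕ} (w : Fin r → E → K) (hw : IsBasisOf w W) :
    (minorIdeal w).radical = minorIdeal w ∧
    minorIdeal w = (jacIdeal w).radical ∧
    (ringChar K ≠ 2 →
      ∀ p ∈ (jacIdeal w).minimalPrimes, ∀ (hp : p.IsPrime),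
        IsReduced ((Localization.AtPrime p (hp := hp)) ⧸
          Ideal.map (algebraMap (MvPolynomial E K) (Localization.AtPrime p (hp := hp)))
            (jacIdeal w))) := by
  exact main w hw.1

end Config
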